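/- arXiv:1112.1233 — 3 statements merged into one kernel-verified Lean document; each statement's English description precedes it below -/
import Mathlib

section
/- Let (p_t(x,·)) be an affine family of transition kernels on K with associated functions φ and ψ, and suppose that for every u ∈ K* the derivative R(u) := ∂_t ψ(t,u)|_{t=0} exists and that R is of form (R) with parameters (Q,Bᵀ,γ,M). Then, for any u ∈ K* and x ∈ K with ⟨u,x⟩ = 0, the following hold: (i) ⟨Q(u,v),x⟩ = 0 for all v ∈ V; (ii) ∫_K ⟨χ(ξ),u⟩ M(x,dξ) < ∞; (iii) ⟨Bᵀ(u),x⟩ − ∫_K ⟨χ(ξ),u⟩ M(x,dξ) ≥ 0. -/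
open MeasureTheory Filter Set
open scoped RealInnerProductSpace ENNReal Topology

variable {V : Type*} [NormedAddCommGroup V] [InnerProductSpace ℝ V] [FiniteDimensional ℝ V]
  [MeasurableSpace V] [BorelSpace V]

/-- The closed dual cone of a set `K`. -/
def dualCone (K : Set V) : Set V := {u | ∀ x ∈ K, 0 ≤ ⟪x, u⟫}

/-- `K` is a proper (pointed) generating closed convex cone. -/
structure IsProperConvexCone (K : Set V) : Prop where
  isClosed : IsClosed K
  convex : Convex ℝ K
  smul_mem : ∀ (c : ℝ), 0 ≤ c → ∀ x ∈ K, c • x ∈ K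
  proper : K ∩ (-K) = {0}
  generating : ∀ v : V, ∃ x ∈ K, ∃ y ∈ K, v = x - y

/-- An affine family of transition kernels on the cone `K`, with associated
functions `φ` and `ψ`. -/
structure AffineTransitionFamily (K : Set V) (φ : ℝ → V → ℝ) (ψ : ℝ → V → V) where
  p : ℝ → V → Measure V
  measurable_p : ∀ t : ℝ, 0 ≤ t → ∀ A : Set V, MeasurableSet A →
      Measurable fun x => p t x A
  subprob : ∀ t : ℝ, 0 ≤ t → ∀ x ∈ K, p t x Set.univ ≤ 1
  supported : ∀ t : ℝ, 0 ≤ t → ∀ x ∈ K, p t x Kᶜ = 0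
  init : ∀ x ∈ K, p 0 x = Measure.dirac x
  chapman : ∀ s t : ℝ, 0 ≤ s → 0 ≤ t → ∀ x ∈ K, ∀ A : Set V, MeasurableSet A →
      p (t + s) x A = ∫⁻ ξ, p t ξ A ∂(p s x)
  weakCont : ∀ x ∈ K, ∀ f : BoundedContinuousFunction V ℝ,
      ContinuousOn (fun s => ∫ ξ, f ξ ∂(p s x)) (Set.Ici (0 : ℝ))
  laplace : ∀ t : ℝ, 0 ≤ t → ∀ u ∈ dualCone K, ∀ x ∈ K,
      ∫ ξ, Real.exp (-⟪u, ξ⟫) ∂(p t x) = Real.exp (-(φ t u) - ⟪ψ t u, x⟫)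

/-- `χ` is a truncation function: continuous, bounded in norm by `1`, and equal to
the identity on a neighborhood of the origin. -/
def IsTruncation {V : Type*} [NormedAddCommGroup V] (χ : V → V) : Prop :=
  Continuous χ ∧ (∀ ξ : V, ‖χ ξ‖ ≤ 1) ∧ ∀ᶠ ξ in nhds (0 : V), χ ξ = ξ

/-- Parameters witnessing that `F` is of form (F). -/
structure FParams {V : Type*} [NormedAddCommGroup V] [InnerProductSpace ℝ V]
    [MeasurableSpace V] (K : Set V) (F : V → ℝ) where
  b : V
  b_mem : b ∈ K
  c : ℝ
  c_nonneg : 0 ≤ c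
  m : Measure V
  m_supp : m Kᶜ = 0
  m_zero : m {0} = 0
  m_int : (∫⁻ ξ, ENNReal.ofReal (min ‖ξ‖ 1) ∂m) < ⊤
  eq : ∀ u ∈ dualCone K, F u = ⟪b, u⟫ + c - ∫ ξ, (Real.exp (-⟪u, ξ⟫) - 1) ∂m

/-- Parameters witnessing that `R` is of form (R) relative to the truncation
function `χ`. -/
structure RParams {V : Type*} [NormedAddCommGroup V] [InnerProductSpace ℝ V]
    [MeasurableSpace V] (K : Set V) (χ : V → V) (R : V → V) where
  Q : V →ₗ[ℝ] V →ₗ[ℝ] V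
  Q_symm : ∀ u v : V, Q u v = Q v u
  Q_pos : ∀ v : V, Q v v ∈ dualCone K
  B : V →ₗ[ℝ] V
  γ : V
  γ_mem : γ ∈ dualCone K
  M : V → Measure V
  M_sigma : ∀ x ∈ K, SigmaFinite (M x)
  M_add : ∀ x ∈ K, ∀ y ∈ K, M (x + y) = M x + M y
  M_smul : ∀ (c : ℝ), 0 ≤ c → ∀ x ∈ K, M (c • x) = ENNReal.ofReal c • M x
  M_supp : ∀ x ∈ K, M x Kᶜ = 0
  M_zero : ∀ x ∈ K, M x {0} = 0
  M_int : ∀ x ∈ K, (∫⁻ ξ, ENNReal.ofReal (min (‖ξ‖ ^ 2) 1) ∂(M x)) < ⊤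
  eq : ∀ u ∈ dualCone K, ∀ x ∈ K,
    ⟪R u, x⟫ = -(1/2) * ⟪Q u u, x⟫ + ⟪B u, x⟫ + ⟪γ, x⟫
      - ∫ ξ, (Real.exp (-⟪u, ξ⟫) - 1 + ⟪χ ξ, u⟫) ∂(M x)

/-- The parameters of form (R) are admissible. -/
def RParams.Admissible {V : Type*} [NormedAddCommGroup V] [InnerProductSpace ℝ V]
    [MeasurableSpace V] {K : Set V} {χ : V → V} {R : V → V}
    (P : RParams K χ R) : Prop :=
  ∀ u ∈ dualCone K, ∀ x ∈ K, ⟪u, x⟫ = 0 →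
    (∀ v : V, ⟪P.Q u v, x⟫ = 0) ∧
    Integrable (fun ξ => ⟪χ ξ, u⟫) (P.M x) ∧
    0 ≤ ⟪P.B u, x⟫ - ∫ ξ, ⟪χ ξ, u⟫ ∂(P.M x)

lemma psi_mem_aux {V : Type*} [NormedAddCommGroup V] [InnerProductSpace ℝ V]
    [FiniteDimensional ℝ V] [MeasurableSpace V] [BorelSpace V]
    (K : Set V) (hK : IsProperConvexCone K)
    (φ : ℝ → V → ℝ) (ψ : ℝ → V → V)
    (X : AffineTransitionFamily K φ ψ) (t : ℝ) (ht : 0 ≤ t) (u : V) (hu : u ∈ dualCone K)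
    (x : V) (hx : x ∈ K) : 0 ≤ ⟪ψ t u, x⟫ := by
  have key : ∀ y ∈ K, 0 ≤ φ t u + ⟪ψ t u, y⟫ := by
    intro y hy
    have h1 := X.subprob t ht y hy
    have : IsFiniteMeasure (X.p t y) := ⟨lt_of_le_of_lt h1 ENNReal.one_lt_top⟩
    have hae : ∀ᵐ ξ ∂(X.p t y), ξ ∈ K := mem_ae_iff.2 (X.supported t ht y hy)
    have h2 : ‖∫ ξ, Real.exp (-⟪u, ξ⟫) ∂(X.p t y)‖ ≤ 1 * (X.p t y).real Set.univ := by
      apply norm_integral_le_of_norm_le_const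
      filter_upwards [hae] with ξ hξ
      have := hu ξ hξ
      rw [real_inner_comm] at this
      rw [Real.norm_eq_abs, abs_of_pos (Real.exp_pos _)]
      exact Real.exp_le_one_iff.2 (by linarith)
    have h3 : (X.p t y).real Set.univ ≤ 1 := ENNReal.toReal_le_of_le_ofReal zero_le_one (by simpa using h1)
    rw [X.laplace t ht u hu y hy, Real.norm_eq_abs, abs_of_pos (Real.exp_pos _)] at h2
    have := Real.exp_le_one_iff.1 (by linarith : Real.exp (-(φ t u) - ⟪ψ t u, y⟫) ≤ 1)
    linarith
  by_contra hneg
  push Not at hneg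
  have h := key (((|φ t u| + 1) / (-⟪ψ t u, x⟫)) • x)
    (hK.smul_mem _ (by apply div_nonneg <;> [positivity; linarith]) x hx)
  rw [inner_smul_right] at h
  have h4 : (|φ t u| + 1) / (-⟪ψ t u, x⟫) * ⟪ψ t u, x⟫ = -(|φ t u| + 1) := by
    have : ⟪ψ t u, x⟫ ≠ 0 := hneg.ne
    field_simp
  have := le_abs_self (φ t u)
  linarith

lemma psi_zero_aux {V : Type*} [NormedAddCommGroup V] [InnerProductSpace ℝ V]
    [FiniteDimensional ℝ V] [MeasurableSpace V] [BorelSpace V]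
    (K : Set V) (hK : IsProperConvexCone K)
    (φ : ℝ → V → ℝ) (ψ : ℝ → V → V)
    (X : AffineTransitionFamily K φ ψ) (u : V) (hu : u ∈ dualCone K)
    (x : V) (hx : x ∈ K) : ⟪ψ 0 u, x⟫ = ⟪u, x⟫ := by
  have key : ∀ y ∈ K, ⟪u, y⟫ = φ 0 u + ⟪ψ 0 u, y⟫ := by
    intro y hy
    have h := X.laplace 0 le_rfl u hu y hy
    rw [X.init y hy, integral_dirac] at h
    have := Real.exp_injective h
    linarith
  have h0 := key 0 (by simpa using hK.smul_mem 0 le_rfl x hx)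
  have h1 := key x hx
  simp at h0
  linarith

lemma R_nonneg_aux {V : Type*} [NormedAddCommGroup V] [InnerProductSpace ℝ V]
    [FiniteDimensional ℝ V] [MeasurableSpace V] [BorelSpace V]
    (K : Set V) (hK : IsProperConvexCone K)
    (φ : ℝ → V → ℝ) (ψ : ℝ → V → V)
    (X : AffineTransitionFamily K φ ψ) (R : V → V)
    (hR : ∀ u ∈ dualCone K, HasDerivWithinAt (fun t => ψ t u) (R u) (Set.Ici (0 : ℝ)) 0)
    (u : V) (hu : u ∈ dualCone K)
    (x : V) (hx : x ∈ K) (hux : ⟪u, x⟫ = 0) : 0 ≤ ⟪R u, x⟫ := by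
  have h1 := HasDerivWithinAt.inner ℝ (hR u hu) (hasDerivWithinAt_const (0:ℝ) (Set.Ici (0:ℝ)) x)
  simp only [inner_zero_right, zero_add] at h1
  have h2 := (hasDerivWithinAt_iff_tendsto_slope.1 h1)
  rw [Set.Ici_sdiff_left] at h2
  refine ge_of_tendsto h2 ?_
  filter_upwards [self_mem_nhdsWithin] with t ht
  have ht' : (0:ℝ) < t := ht
  rw [slope_def_field]
  have := psi_mem_aux K hK φ ψ X t ht'.le u hu x hx
  rw [psi_zero_aux K hK φ ψ X u hu x hx, hux]
  apply div_nonneg <;> linarith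

lemma exp_upper_aux (a : ℝ) (ha : 0 ≤ a) : Real.exp (-a) - 1 + a ≤ a ^ 2 := by
  by_cases h : a ≤ 1
  · have := Real.abs_exp_sub_one_sub_id_le (x := -a) (by rw [abs_neg, abs_of_nonneg ha]; exact h)
    have := (abs_le.1 this).2
    nlinarith
  · have : Real.exp (-a) ≤ 1 := Real.exp_le_one_iff.2 (by linarith)
    nlinarith

theorem R_params_admissible
    {V : Type*} [NormedAddCommGroup V] [InnerProductSpace ℝ V] [FiniteDimensional ℝ V]
    [MeasurableSpace V] [BorelSpace V]
    (K : Set V) (hK : IsProperConvexCone K)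
    (φ : ℝ → V → ℝ) (ψ : ℝ → V → V)
    (X : AffineTransitionFamily K φ ψ)
    (χ : V → V) (hχ : IsTruncation χ)
    (R : V → V)
    (hR : ∀ u ∈ dualCone K, HasDerivWithinAt (fun t => ψ t u) (R u) (Set.Ici (0 : ℝ)) 0)
    (P : RParams K χ R) :
    P.Admissible := by
  intro u hu x hx hux
  obtain ⟨hχc, hχb, hχ0⟩ := hχ
  have hsu : ∀ s : ℝ, 0 ≤ s → s • u ∈ dualCone K := by
    intro s hs y hy
    rw [inner_smul_right]
    exact mul_nonneg hs (hu y hy)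
  have hae : ∀ᵐ ξ ∂(P.M x), ξ ∈ K := mem_ae_iff.2 (P.M_supp x hx)
  have hmi : Integrable (fun ξ : V => min (‖ξ‖ ^ 2) 1) (P.M x) := by
    refine ⟨by fun_prop, ?_⟩
    rw [hasFiniteIntegral_iff_ofReal]
    · exact P.M_int x hx
    · filter_upwards with ξ
      positivity
  obtain ⟨δ₀, hδ₀, hball⟩ := Metric.eventually_nhds_iff.1 hχ0
  obtain ⟨δ, hδ, hδ1, hloc⟩ : ∃ δ : ℝ, 0 < δ ∧ δ ≤ 1 ∧ ∀ ξ : V, ‖ξ‖ < δ → χ ξ = ξ := by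
    refine ⟨min δ₀ 1, by positivity, min_le_right _ _, fun ξ hξ => hball ?_⟩
    rw [dist_zero_right]
    exact lt_of_lt_of_le hξ (min_le_left _ _)
  have hmin : ∀ ξ : V, δ ≤ ‖ξ‖ → 1 ≤ (1 / δ ^ 2) * min (‖ξ‖ ^ 2) 1 := by
    intro ξ hξ
    have : δ ^ 2 ≤ min (‖ξ‖ ^ 2) 1 := by
      apply le_min
      · gcongr
      · nlinarith
    rw [one_div, ← div_eq_inv_mul, le_div_iff₀ (by positivity)]
    linarith
  have hcb : ∀ w ξ : V, |⟪χ ξ, w⟫| ≤ ‖w‖ := by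
    intro w ξ
    calc |⟪χ ξ, w⟫| ≤ ‖χ ξ‖ * ‖w‖ := abs_real_inner_le_norm _ _
      _ ≤ 1 * ‖w‖ := by gcongr; exact hχb ξ
      _ = ‖w‖ := one_mul _
  -- pointwise bounds
  have hlow : ∀ w ∈ dualCone K, ∀ ξ ∈ K,
      -((1 + ‖w‖) * ((1 / δ ^ 2) * min (‖ξ‖ ^ 2) 1)) ≤ Real.exp (-⟪w, ξ⟫) - 1 + ⟪χ ξ, w⟫ := by
    intro w hw ξ hξ
    by_cases h : ‖ξ‖ < δ
    · rw [hloc ξ h, real_inner_comm w ξ]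
      have h1 := Real.add_one_le_exp (-⟪w, ξ⟫)
      have h2 : 0 ≤ (1 + ‖w‖) * ((1 / δ ^ 2) * min (‖ξ‖ ^ 2) 1) := by positivity
      rw [real_inner_comm] at h1
      simp only [real_inner_comm] at h1 ⊢
      linarith
    · have h1 := hmin ξ (not_lt.1 h)
      have h2 := (abs_le.1 (hcb w ξ)).1
      have h3 := Real.exp_pos (-⟪w, ξ⟫)
      have h4 := norm_nonneg w
      nlinarith
  have hup : ∀ w ∈ dualCone K, ∀ ξ ∈ K,
      Real.exp (-⟪w, ξ⟫) - 1 + ⟪χ ξ, w⟫ ≤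
        (‖w‖ ^ 2 + ‖w‖ * (1 / δ ^ 2)) * min (‖ξ‖ ^ 2) 1 := by
    intro w hw ξ hξ
    have ha : 0 ≤ ⟪w, ξ⟫ := by rw [real_inner_comm]; exact hw ξ hξ
    by_cases h : ‖ξ‖ < δ
    · rw [hloc ξ h, real_inner_comm w ξ]
      have h1 := exp_upper_aux _ ha
      have h3 : ⟪w, ξ⟫ ≤ ‖w‖ * ‖ξ‖ := real_inner_le_norm _ _
      have h5 : ⟪w, ξ⟫ ^ 2 ≤ (‖w‖ * ‖ξ‖) ^ 2 := by gcongr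
      have h4 : min (‖ξ‖ ^ 2) 1 = ‖ξ‖ ^ 2 := min_eq_left (by nlinarith [norm_nonneg ξ])
      have h2 : 0 ≤ ‖w‖ * (1 / δ ^ 2) * ‖ξ‖ ^ 2 := by positivity
      rw [h4]
      simp only [real_inner_comm] at *
      nlinarith
    · have h1 := hmin ξ (not_lt.1 h)
      have h2 := (abs_le.1 (hcb w ξ)).2
      have h3 : Real.exp (-⟪w, ξ⟫) ≤ 1 := Real.exp_le_one_iff.2 (by linarith)
      have h4 := norm_nonneg w
      have h5 : 0 ≤ ‖w‖ ^ 2 * min (‖ξ‖ ^ 2) 1 := by positivity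
      nlinarith
  have hint : ∀ w ∈ dualCone K,
      Integrable (fun ξ => Real.exp (-⟪w, ξ⟫) - 1 + ⟪χ ξ, w⟫) (P.M x) := by
    intro w hw
    refine integrable_of_le_of_le (g₁ := fun ξ => -((1 + ‖w‖) * ((1 / δ ^ 2) * min (‖ξ‖ ^ 2) 1)))
      (g₂ := fun ξ => (‖w‖ ^ 2 + ‖w‖ * (1 / δ ^ 2)) * min (‖ξ‖ ^ 2) 1) ?_ ?_ ?_ ?_ ?_
    · apply Continuous.aestronglyMeasurable
      fun_prop
    · filter_upwards [hae] with ξ hξ using hlow w hw ξ hξ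
    · filter_upwards [hae] with ξ hξ using hup w hw ξ hξ
    · exact ((hmi.const_mul _).const_mul _).neg
    · exact hmi.const_mul _
  -- main inequality
  have main : ∀ s : ℝ, 0 ≤ s → 0 ≤ -(1/2) * (s ^ 2 * ⟪P.Q u u, x⟫) + s * ⟪P.B u, x⟫ + ⟪P.γ, x⟫
      - ∫ ξ, (Real.exp (-⟪s • u, ξ⟫) - 1 + ⟪χ ξ, s • u⟫) ∂(P.M x) := by
    intro s hs
    have h1 := R_nonneg_aux K hK φ ψ X R hR (s • u) (hsu s hs) x hx
      (by rw [real_inner_smul_left, hux, mul_zero])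
    rw [P.eq _ (hsu s hs) x hx] at h1
    simp only [map_smul, LinearMap.smul_apply, real_inner_smul_left] at h1 ⊢
    convert h1 using 4
    ring
  have hQnn : ∀ v : V, 0 ≤ ⟪P.Q v v, x⟫ := fun v => by
    rw [real_inner_comm]; exact P.Q_pos v x hx
  -- q = 0
  have hq : ⟪P.Q u u, x⟫ = 0 := by
    apply le_antisymm _ (hQnn u)
    by_contra hpos
    push Not at hpos
    set C := ∫ ξ, ((1 / δ ^ 2) * min (‖ξ‖ ^ 2) 1) ∂(P.M x) with hC
    have hC0 : 0 ≤ C := integral_nonneg fun ξ => by positivity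
    have hb : ∀ s : ℝ, 0 ≤ s → -((1 + s * ‖u‖) * C) ≤
        ∫ ξ, (Real.exp (-⟪s • u, ξ⟫) - 1 + ⟪χ ξ, s • u⟫) ∂(P.M x) := by
      intro s hs
      have h1 : ∫ ξ, -((1 + ‖s • u‖) * ((1 / δ ^ 2) * min (‖ξ‖ ^ 2) 1)) ∂(P.M x) ≤
          ∫ ξ, (Real.exp (-⟪s • u, ξ⟫) - 1 + ⟪χ ξ, s • u⟫) ∂(P.M x) := by
        apply integral_mono_ae (((hmi.const_mul _).const_mul _).neg) (hint _ (hsu s hs))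
        filter_upwards [hae] with ξ hξ using hlow _ (hsu s hs) ξ hξ
      rw [integral_neg, integral_const_mul, ← hC, norm_smul, Real.norm_of_nonneg hs] at h1
      exact h1
    set q := ⟪P.Q u u, x⟫
    set A := |⟪P.B u, x⟫| + ‖u‖ * C + |⟪P.γ, x⟫| + C with hA
    have hA0 : 0 ≤ A := by positivity
    have hs1 : 1 ≤ 1 + 2 * A / q + 1 := by
      have : 0 ≤ 2 * A / q := by positivity
      linarith
    set s := 1 + 2 * A / q + 1 with hs
    have hs0 : 0 ≤ s := by linarith
    have h1 := main s hs0
    have h2 := hb s hs0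
    have h3 : s * q = 2 * q + 2 * A := by rw [hs]; field_simp; ring
    have h4 : s ^ 2 * q = s * (2 * q + 2 * A) := by rw [← h3]; ring
    have h5 := le_abs_self ⟪P.B u, x⟫
    have h6 := le_abs_self ⟪P.γ, x⟫
    have h7 : s * ⟪P.B u, x⟫ ≤ s * |⟪P.B u, x⟫| := by gcongr
    have h8 : |⟪P.γ, x⟫| ≤ s * |⟪P.γ, x⟫| := le_mul_of_one_le_left (abs_nonneg _) hs1
    have h9 : C ≤ s * C := le_mul_of_one_le_left hC0 hs1
    have h10 : 0 < s * q := by positivity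
    rw [h4] at h1
    have h11 : s * A = s * |⟪P.B u, x⟫| + s * ‖u‖ * C + s * |⟪P.γ, x⟫| + s * C := by
      rw [hA]; ring
    nlinarith
  have hQ : ∀ v : V, ⟪P.Q u v, x⟫ = 0 := by
    intro v
    have hexp : ∀ r : ℝ, 0 ≤ 2 * r * ⟪P.Q u v, x⟫ + ⟪P.Q v v, x⟫ := by
      intro r
      have h := hQnn (r • u + v)
      simp only [map_add, map_smul, LinearMap.add_apply, LinearMap.smul_apply, inner_add_left,
        real_inner_smul_left, hq, P.Q_symm v u] at h
      linarith
    by_contra hne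
    have h := hexp (-(⟪P.Q v v, x⟫ + 1) / (2 * ⟪P.Q u v, x⟫))
    have h' : 2 * (-(⟪P.Q v v, x⟫ + 1) / (2 * ⟪P.Q u v, x⟫)) * ⟪P.Q u v, x⟫
      = -(⟪P.Q v v, x⟫ + 1) := by field_simp
    linarith
  refine ⟨hQ, ?_⟩
  -- part (ii), (iii)
  set b := ⟪P.B u, x⟫
  set g := ⟪P.γ, x⟫
  set F1 : V → ℝ := fun ξ => Real.exp (-⟪u, ξ⟫) - 1 + ⟪χ ξ, u⟫ with hF1
  have hF1i : Integrable F1 (P.M x) := hint u hu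
  let f : ℕ → V → ℝ := fun n ξ =>
    (1 / (n + 1 : ℝ)) * (Real.exp (-⟪(n + 1 : ℝ) • u, ξ⟫) - 1 + ⟪χ ξ, (n + 1 : ℝ) • u⟫) - F1 ξ
  have hfi : ∀ n, Integrable (f n) (P.M x) := fun n =>
    ((hint _ (hsu _ (by positivity))).const_mul _).sub hF1i
  have hfe : ∀ n ξ, f n ξ = (1 - Real.exp (-⟪u, ξ⟫)) -
      (1 / (n + 1 : ℝ)) * (1 - Real.exp (-⟪u, ξ⟫) ^ (n + 1)) := by
    intro n ξ
    have h0 : (n + 1 : ℝ) ≠ 0 := by positivity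
    have : Real.exp (-⟪(n + 1 : ℝ) • u, ξ⟫) = Real.exp (-⟪u, ξ⟫) ^ (n + 1) := by
      rw [← Real.exp_nat_mul, real_inner_smul_left]
      push_cast
      ring_nf
    simp only [f, F1, this, inner_smul_right]
    field_simp
    ring
  have hf0 : ∀ n ξ, 0 ≤ f n ξ := by
    intro n ξ
    rw [hfe]
    have h1 := one_add_mul_le_pow (a := Real.exp (-⟪u, ξ⟫) - 1)
      (by have := Real.exp_pos (-⟪u, ξ⟫); linarith) (n + 1)
    rw [add_sub_cancel] at h1
    push_cast at h1
    have h0 : (0:ℝ) < n + 1 := by positivity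
    have : (1 / (n + 1 : ℝ)) * (1 - Real.exp (-⟪u, ξ⟫) ^ (n + 1)) ≤ 1 - Real.exp (-⟪u, ξ⟫) := by
      rw [one_div, ← div_eq_inv_mul, div_le_iff₀ h0]
      linarith
    linarith
  have hfb : ∀ n, ∫ ξ, f n ξ ∂(P.M x) ≤ b + (1 / (n + 1 : ℝ)) * g - ∫ ξ, F1 ξ ∂(P.M x) := by
    intro n
    have h0 : (0:ℝ) < n + 1 := by positivity
    have h1 := main (n + 1) h0.le
    simp only [f]
    rw [integral_sub ((hint _ (hsu _ h0.le)).const_mul _) hF1i, integral_const_mul]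
    rw [hq] at h1
    have : (1 / (n + 1 : ℝ)) * ∫ ξ, (Real.exp (-⟪(n + 1 : ℝ) • u, ξ⟫) - 1 + ⟪χ ξ, (n + 1 : ℝ) • u⟫) ∂(P.M x)
        ≤ b + (1 / (n + 1 : ℝ)) * g := by
      rw [one_div, ← div_eq_inv_mul, div_le_iff₀ h0, add_mul]
      have : (n + 1 : ℝ)⁻¹ * g * (n + 1) = g := by field_simp
      linarith
    linarith
  set L := b - ∫ ξ, F1 ξ ∂(P.M x) with hL
  have hlim1 : Tendsto (fun n : ℕ => (1 / (n + 1 : ℝ))) atTop (𝓝 0) :=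
    tendsto_one_div_add_atTop_nhds_zero_nat
  have hlimR : Tendsto (fun n : ℕ => b + (1 / (n + 1 : ℝ)) * g - ∫ ξ, F1 ξ ∂(P.M x)) atTop (𝓝 L) := by
    have := ((hlim1.mul_const g).const_add b).sub_const (∫ ξ, F1 ξ ∂(P.M x))
    simpa [hL] using this
  have hL0 : 0 ≤ L := ge_of_tendsto hlimR (Eventually.of_forall fun n =>
    (integral_nonneg (hf0 n)).trans (hfb n))
  have hfl : ∀ ξ ∈ K, Tendsto (fun n => ENNReal.ofReal (f n ξ)) atTop
      (𝓝 (ENNReal.ofReal (1 - Real.exp (-⟪u, ξ⟫)))) := by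
    intro ξ hξ
    apply ENNReal.tendsto_ofReal
    have ha : 0 ≤ ⟪u, ξ⟫ := by rw [real_inner_comm]; exact hu ξ hξ
    have h3 : Real.exp (-⟪u, ξ⟫) ≤ 1 := Real.exp_le_one_iff.2 (by linarith)
    have hz : Tendsto (fun n : ℕ => (1 / (n + 1 : ℝ)) * (1 - Real.exp (-⟪u, ξ⟫) ^ (n + 1)))
        atTop (𝓝 0) := by
      refine squeeze_zero (fun n => ?_) (fun n => ?_) hlim1
      · have := pow_le_one₀ (n := n + 1) (Real.exp_pos (-⟪u, ξ⟫)).le h3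
        apply mul_nonneg (by positivity)
        linarith
      · apply mul_le_of_le_one_right (by positivity)
        have := pow_pos (Real.exp_pos (-⟪u, ξ⟫)) (n + 1)
        linarith
    simp only [hfe]
    simpa using hz.const_sub (1 - Real.exp (-⟪u, ξ⟫))
  have hfat : ∫⁻ ξ, ENNReal.ofReal (1 - Real.exp (-⟪u, ξ⟫)) ∂(P.M x) ≤ ENNReal.ofReal L := by
    calc ∫⁻ ξ, ENNReal.ofReal (1 - Real.exp (-⟪u, ξ⟫)) ∂(P.M x)
        = ∫⁻ ξ, liminf (fun n => ENNReal.ofReal (f n ξ)) atTop ∂(P.M x) := by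
          apply lintegral_congr_ae
          filter_upwards [hae] with ξ hξ using (hfl ξ hξ).liminf_eq.symm
      _ ≤ liminf (fun n => ∫⁻ ξ, ENNReal.ofReal (f n ξ) ∂(P.M x)) atTop := by
          apply lintegral_liminf_le'
          intro n
          exact (hfi n).aestronglyMeasurable.aemeasurable.ennreal_ofReal
      _ ≤ liminf (fun n : ℕ => ENNReal.ofReal (b + (1 / (n + 1 : ℝ)) * g - ∫ ξ, F1 ξ ∂(P.M x))) atTop := by
          refine liminf_le_liminf (Eventually.of_forall fun n => ?_)
          rw [← ofReal_integral_eq_lintegral_ofReal (hfi n) (Eventually.of_forall (hf0 n))]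
          exact ENNReal.ofReal_le_ofReal (hfb n)
      _ = ENNReal.ofReal L := (ENNReal.tendsto_ofReal hlimR).liminf_eq
  have hnn : ∀ᵐ ξ ∂(P.M x), 0 ≤ 1 - Real.exp (-⟪u, ξ⟫) := by
    filter_upwards [hae] with ξ hξ
    have ha : 0 ≤ ⟪u, ξ⟫ := by rw [real_inner_comm]; exact hu ξ hξ
    have h3 : Real.exp (-⟪u, ξ⟫) ≤ 1 := Real.exp_le_one_iff.2 (by linarith)
    linarith
  have hei : Integrable (fun ξ => 1 - Real.exp (-⟪u, ξ⟫)) (P.M x) := by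
    refine ⟨Continuous.aestronglyMeasurable (by fun_prop), ?_⟩
    rw [hasFiniteIntegral_iff_ofReal hnn]
    exact lt_of_le_of_lt hfat ENNReal.ofReal_lt_top
  have hev : ∫ ξ, (1 - Real.exp (-⟪u, ξ⟫)) ∂(P.M x) ≤ L := by
    rw [← ENNReal.ofReal_le_ofReal_iff hL0, ofReal_integral_eq_lintegral_ofReal hei hnn]
    exact hfat
  have hsum : (fun ξ => ⟪χ ξ, u⟫) = fun ξ => (1 - Real.exp (-⟪u, ξ⟫)) + F1 ξ := by
    funext ξ
    simp only [hF1]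
    ring
  rw [hsum]
  refine ⟨hei.add hF1i, ?_⟩
  rw [integral_add hei hF1i]
  linarith
end

section
/- Let R : K* → V be of form (R) with parameters (Q,Bᵀ,γ,M) that are admissible. Then R is quasi-monotone increasing on K* with respect to K*: for all u,v ∈ K* and x ∈ K satisfying u ⪯ v and ⟨u,x⟩ = ⟨v,x⟩, one has ⟨R(u),x⟩ ≤ ⟨R(v),x⟩. -/
open MeasureTheory Filter Set
open scoped RealInnerProductSpace ENNReal Topology

variable {V : Type*} [NormedAddCommGroup V] [InnerProductSpace ℝ V] [FiniteDimensional ℝ V]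
  [MeasurableSpace V] [BorelSpace V]

theorem g_integrable_aux
    {V : Type*} [NormedAddCommGroup V] [InnerProductSpace ℝ V] [FiniteDimensional ℝ V]
    [MeasurableSpace V] [BorelSpace V]
    (K : Set V) (χ : V → V) (hχ : IsTruncation χ) (m : Measure V)
    (hs : m Kᶜ = 0) (hm : (∫⁻ ξ, ENNReal.ofReal (min (‖ξ‖ ^ 2) 1) ∂m) < ⊤)
    (u : V) (hu : u ∈ dualCone K) :
    Integrable (fun ξ => Real.exp (-⟪u, ξ⟫) - 1 + ⟪χ ξ, u⟫) m := by
  obtain ⟨hc, hb, hn⟩ := hχ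
  obtain ⟨ε, hε, hball⟩ := Metric.eventually_nhds_iff.1 hn
  have hint : Integrable (fun ξ : V => min (‖ξ‖ ^ 2) 1) m := by
    have hcont : Continuous (fun ξ : V => min (‖ξ‖ ^ 2) 1) := by fun_prop
    refine ⟨hcont.aestronglyMeasurable, ?_⟩
    rw [hasFiniteIntegral_iff_ofReal]
    · exact hm
    · exact Eventually.of_forall fun ξ => by
        show 0 ≤ min (‖ξ‖ ^ 2) 1
        positivity
  set δ := min (ε ^ 2) 1 with hδ
  have hδ0 : 0 < δ := by positivity
  have hδ1 : δ ≤ 1 := min_le_right _ _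
  refine Integrable.mono' (hint.const_mul (‖u‖ ^ 2 + (1 + ‖u‖) / δ)) ?_ ?_
  · have : Continuous (fun ξ => Real.exp (-⟪u, ξ⟫) - 1 + ⟪χ ξ, u⟫) := by fun_prop
    exact this.aestronglyMeasurable
  have hae : ∀ᵐ ξ ∂m, ξ ∈ K := by
    rw [ae_iff]; exact hs
  filter_upwards [hae] with ξ hξ
  have hp : 0 ≤ ⟪u, ξ⟫ := by rw [real_inner_comm]; exact hu ξ hξ
  have he1 : Real.exp (-⟪u, ξ⟫) ≤ 1 := Real.exp_le_one_iff.2 (by linarith)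
  have he0 := Real.exp_pos (-⟪u, ξ⟫)
  have hab : |⟪χ ξ, u⟫| ≤ ‖u‖ := by
    refine (abs_real_inner_le_norm _ _).trans ?_
    exact mul_le_of_le_one_left (norm_nonneg _) (hb ξ)
  have hA : |Real.exp (-⟪u, ξ⟫) - 1 + ⟪χ ξ, u⟫| ≤ 1 + ‖u‖ := by
    rw [abs_le] at hab ⊢
    constructor <;> linarith [hab.1, hab.2]
  have hq : 0 ≤ (1 + ‖u‖) / δ := by positivity
  have hbig : δ ≤ min (‖ξ‖ ^ 2) 1 → ‖Real.exp (-⟪u, ξ⟫) - 1 + ⟪χ ξ, u⟫‖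
      ≤ (‖u‖ ^ 2 + (1 + ‖u‖) / δ) * min (‖ξ‖ ^ 2) 1 := by
    intro h
    rw [Real.norm_eq_abs]
    calc _ ≤ 1 + ‖u‖ := hA
      _ = (1 + ‖u‖) / δ * δ := by field_simp
      _ ≤ (‖u‖ ^ 2 + (1 + ‖u‖) / δ) * min (‖ξ‖ ^ 2) 1 := by
        gcongr
        linarith [sq_nonneg ‖u‖]
  by_cases h1 : 1 ≤ ‖ξ‖
  · apply hbig
    rw [min_eq_right (by nlinarith)]
    exact hδ1
  by_cases h2 : ε ≤ ‖ξ‖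
  · apply hbig
    rw [hδ]
    gcongr
  push Not at h1 h2
  have hx : χ ξ = ξ := hball (by simpa using h2)
  rw [min_eq_left (by nlinarith [norm_nonneg ξ]), hx, real_inner_comm u ξ, Real.norm_eq_abs]
  have hs1 : ⟪u, ξ⟫ ≤ ‖u‖ * ‖ξ‖ := real_inner_le_norm _ _
  have key : |Real.exp (-⟪u, ξ⟫) - 1 + ⟪u, ξ⟫| ≤ ⟪u, ξ⟫ ^ 2 := by
    by_cases h : ⟪u, ξ⟫ ≤ 1
    · have := Real.abs_exp_sub_one_sub_id_le (x := -⟪u, ξ⟫) (by rw [abs_neg, abs_of_nonneg hp]; exact h)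
      simpa using this
    · rw [abs_le]
      constructor <;> nlinarith [Real.add_one_le_exp (-⟪u, ξ⟫)]
  calc _ ≤ ⟪u, ξ⟫ ^ 2 := key
    _ ≤ (‖u‖ * ‖ξ‖) ^ 2 := by gcongr
    _ = ‖u‖ ^ 2 * ‖ξ‖ ^ 2 := by ring
    _ ≤ _ := by
      gcongr
      linarith

/-- If `R` is of form (R) with admissible parameters, then `R` is
quasi-monotone increasing on `K*` with respect to `K*`: for `u,v ∈ K*` and `x ∈ K`
with `u ⪯ v` and `⟪u,x⟫ = ⟪v,x⟫`, one has `⟪R(u),x⟫ ≤ ⟪R(v),x⟫`. -/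
theorem R_quasiMonotone
    {V : Type*} [NormedAddCommGroup V] [InnerProductSpace ℝ V] [FiniteDimensional ℝ V]
    [MeasurableSpace V] [BorelSpace V]
    (K : Set V) (hK : IsProperConvexCone K)
    (χ : V → V) (hχ : IsTruncation χ)
    (R : V → V) (P : RParams K χ R) (hadm : P.Admissible) :
    ∀ u ∈ dualCone K, ∀ v ∈ dualCone K, ∀ x ∈ K,
      v - u ∈ dualCone K → ⟪u, x⟫ = ⟪v, x⟫ → ⟪R u, x⟫ ≤ ⟪R v, x⟫ := by
  intro u hu v hv x hx hw hux
  obtain ⟨w, rfl⟩ : ∃ w, v = u + w := ⟨v - u, by abel⟩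
  rw [add_sub_cancel_left] at hw
  have hwx : ⟪w, x⟫ = 0 := by
    rw [inner_add_left] at hux; linarith
  obtain ⟨hQ, hI, hB⟩ := hadm w hw x hx hwx
  rw [P.eq u hu x hx, P.eq (u + w) hv x hx]
  have hiu := g_integrable_aux K χ hχ (P.M x) (P.M_supp x hx) (P.M_int x hx) u hu
  have hiv := g_integrable_aux K χ hχ (P.M x) (P.M_supp x hx) (P.M_int x hx) (u + w) hv
  have hle : ∫ ξ, (Real.exp (-⟪u + w, ξ⟫) - 1 + ⟪χ ξ, u + w⟫) ∂(P.M x) ≤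
      ∫ ξ, ((Real.exp (-⟪u, ξ⟫) - 1 + ⟪χ ξ, u⟫) + ⟪χ ξ, w⟫) ∂(P.M x) := by
    refine integral_mono_ae hiv (hiu.add hI) ?_
    have hae : ∀ᵐ ξ ∂(P.M x), ξ ∈ K := by
      rw [ae_iff]; exact P.M_supp x hx
    filter_upwards [hae] with ξ hξ
    have hp : 0 ≤ ⟪w, ξ⟫ := by rw [real_inner_comm]; exact hw ξ hξ
    have : Real.exp (-⟪u + w, ξ⟫) ≤ Real.exp (-⟪u, ξ⟫) := by
      apply Real.exp_le_exp.2
      rw [inner_add_left]; linarith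
    rw [inner_add_right]
    linarith
  rw [integral_add hiu hI] at hle
  have hQQ : ⟪P.Q (u + w) (u + w), x⟫ = ⟪P.Q u u, x⟫ := by
    simp only [map_add, LinearMap.add_apply, inner_add_left, P.Q_symm u w, hQ]
    ring
  rw [hQQ, map_add, inner_add_left]
  linarith
end

section
/- Let F : K* → ℝ be of form (F) and let R : K* → V be of form (R) with admissible parameters. Then, for every u ∈ K̊*, there exists a unique global solution (φ(·,u), ψ(·,u)) : ℝ₊ → ℝ₊ × K̊* of the generalized Riccati equations ∂_t φ(t,u) = F(ψ(t,u)) with φ(0,u) = 0 and ∂_t ψ(t,u) = R(ψ(t,u)) with ψ(0,u) = u; moreover, φ(t,u) and ψ(t,u) are real-analytic in (t,u) ∈ ℝ₊ × K̊* (each point has a neighborhood in ℝ × V on which the solution extends real-analytically). -/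
open MeasureTheory Filter Set
open scoped RealInnerProductSpace ENNReal Topology

variable {V : Type*} [NormedAddCommGroup V] [InnerProductSpace ℝ V] [FiniteDimensional ℝ V]
  [MeasurableSpace V] [BorelSpace V]

section RicA
variable {E : Type*} [NormedAddCommGroup E] [NormedSpace ℝ E]

/-- pointwise application of a multilinear map to continuous paths -/
noncomputable def ricPt {n : ℕ} (f : ContinuousMultilinearMap ℝ (fun _ : Fin n => E) E) :
    ContinuousMultilinearMap ℝ (fun _ : Fin n => C(unitInterval, E)) C(unitInterval, E) :=
  MultilinearMap.mkContinuous
    { toFun := fun h => ⟨fun s => f (fun i => h i s), by fun_prop⟩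
      map_update_add' := by
        intro _ h i x y
        ext s
        have key : ∀ z : C(unitInterval, E), (fun j => (Function.update h i z j) s)
            = Function.update (fun j => h j s) i (z s) := by
          intro z; ext j
          by_cases hj : j = i
          · subst hj; simp
          · simp [hj]
        simp [key]
      map_update_smul' := by
        intro _ h i c x
        ext s
        have key : ∀ z : C(unitInterval, E), (fun j => (Function.update h i z j) s)
            = Function.update (fun j => h j s) i (z s) := by
          intro z; ext j
          by_cases hj : j = i
          · subst hj; simp
          · simp [hj]
        simp [key] } ‖f‖ (by
        intro h
        refine (ContinuousMap.norm_le _ (by positivity)).2 fun s => ?_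
        refine (f.le_opNorm _).trans ?_
        gcongr with i
        exact (h i).norm_coe_le_norm s)

lemma ricPt_apply {n : ℕ} (f : ContinuousMultilinearMap ℝ (fun _ : Fin n => E) E)
    (h : Fin n → C(unitInterval, E)) (s : unitInterval) :
    ricPt f h s = f (fun i => h i s) := rfl

lemma ricPt_norm {n : ℕ} (f : ContinuousMultilinearMap ℝ (fun _ : Fin n => E) E) :
    ‖ricPt f‖ ≤ ‖f‖ := MultilinearMap.mkContinuous_norm_le _ (norm_nonneg _) _

/-- Nemytskii operator is analytic near a constant path. -/
lemma ric_nemytskii [CompleteSpace E] {W : E → E} {x₀ : E} (hW : AnalyticAt ℝ W x₀) :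
    ∃ N : C(unitInterval, E) → C(unitInterval, E),
      AnalyticAt ℝ N (ContinuousMap.const _ x₀) ∧
      ∀ᶠ y in 𝓝 (ContinuousMap.const unitInterval x₀), ∀ s, N y s = W (y s) := by
  obtain ⟨p, r, hp⟩ := hW
  let P : FormalMultilinearSeries ℝ C(unitInterval, E) C(unitInterval, E) := fun n => ricPt (p n)
  have hPr : p.radius ≤ P.radius := FormalMultilinearSeries.radius_le_of_le fun n => ricPt_norm _
  have hpos : 0 < P.radius := lt_of_lt_of_le (lt_of_lt_of_le hp.r_pos hp.r_le) hPr
  have hP := (P.hasFPowerSeriesOnBall hpos).comp_sub (ContinuousMap.const _ x₀)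
  rw [zero_add] at hP
  refine ⟨_, hP.analyticAt, ?_⟩
  have hr := hp.r_pos
  filter_upwards [Metric.eball_mem_nhds (ContinuousMap.const unitInterval x₀) hr] with y hy s
  have hy' : y - ContinuousMap.const unitInterval x₀ ∈ Metric.eball 0 r := by
    simpa [edist_eq_enorm_sub] using hy
  have hys : y s - x₀ ∈ Metric.eball 0 r := by
    rw [Metric.mem_eball, edist_zero_right] at hy' ⊢
    refine lt_of_le_of_lt ?_ hy'
    have := (y - ContinuousMap.const unitInterval x₀).norm_coe_le_norm s
    simpa [enorm_le_iff_norm_le] using this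
  have h1 := P.hasSum (x := y - ContinuousMap.const unitInterval x₀)
    (Metric.eball_subset_eball (hp.r_le.trans hPr) hy')
  have h2 := h1.mapL (ContinuousMap.evalCLM ℝ s)
  have h3 := hp.hasSum hys
  have h5 : HasSum (fun b => (ContinuousMap.evalCLM ℝ s)
      ((P b) fun _ => y - ContinuousMap.const (↑unitInterval) x₀)) (W (x₀ + (y s - x₀))) := h3
  have h4 := h2.unique h5
  simpa using h4

/-- integration operator -/
noncomputable def ricInt [CompleteSpace E] : C(unitInterval, E) →L[ℝ] C(unitInterval, E) :=
  LinearMap.mkContinuous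
    { toFun := fun y => ⟨fun s => ∫ σ in (0:ℝ)..s, Set.IccExtend zero_le_one y σ, by
        have hc : Continuous (Set.IccExtend (zero_le_one' ℝ) y) := y.continuous.Icc_extend'
        exact (intervalIntegral.continuous_primitive (fun a b => hc.intervalIntegrable a b) 0).comp
          continuous_subtype_val⟩
      map_add' := by
        intro x y
        ext s
        have hx : Continuous (Set.IccExtend (zero_le_one' ℝ) x) := x.continuous.Icc_extend'
        have hy : Continuous (Set.IccExtend (zero_le_one' ℝ) y) := y.continuous.Icc_extend'
        simp only [ContinuousMap.coe_mk, ContinuousMap.add_apply]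
        rw [← intervalIntegral.integral_add (hx.intervalIntegrable _ _) (hy.intervalIntegrable _ _)]
        rfl
      map_smul' := by
        intro c x
        ext s
        simp only [ContinuousMap.coe_mk, ContinuousMap.smul_apply, RingHom.id_apply]
        rw [← intervalIntegral.integral_smul]
        rfl } 1 (by
        intro y
        rw [one_mul]
        refine (ContinuousMap.norm_le _ (by positivity)).2 fun s => ?_
        have := intervalIntegral.norm_integral_le_of_norm_le_const (a := 0) (b := (s:ℝ))
          (f := Set.IccExtend (zero_le_one' ℝ) y) (C := ‖y‖)
          (fun σ _ => y.norm_coe_le_norm _)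
        refine this.trans ?_
        have h1 : |(s:ℝ) - 0| ≤ 1 := by
          rw [sub_zero, abs_of_nonneg s.2.1]; exact s.2.2
        nlinarith [norm_nonneg y])

lemma ricInt_apply [CompleteSpace E] (y : C(unitInterval, E)) (s : unitInterval) :
    ricInt y s = ∫ σ in (0:ℝ)..s, Set.IccExtend zero_le_one y σ := rfl


/-- Local analytic flow. -/
lemma ric_local_flow [CompleteSpace E] {W : E → E} {x₀ : E} (hW : AnalyticAt ℝ W x₀) :
    ∃ α : E × ℝ → E, ∃ ε > (0:ℝ),
      (∀ x ∈ Metric.closedBall x₀ ε, α (x, 0) = x ∧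
        ∀ t ∈ Icc (-ε) ε, HasDerivWithinAt (fun t => α (x, t)) (W (α (x, t))) (Icc (-ε) ε) t) ∧
      ContinuousAt α (x₀, 0) ∧
      AnalyticAt ℝ (fun q : ℝ × E => α (q.2, q.1)) (0, x₀) := by
  obtain ⟨ε₁, hε₁, a, r, L, K, hr, hPL⟩ :=
    IsPicardLindelof.of_contDiffAt_one (hW.contDiffAt (n := 1))
  obtain ⟨α, hα, hαc⟩ := (hPL 0).exists_forall_mem_closedBall_eq_hasDerivWithinAt_continuousOn
  have hr' : (0:ℝ) < r := hr
  simp only [zero_sub, zero_add] at hα hαc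
  have hca : ContinuousAt α (x₀, 0) := hαc.continuousAt
    (prod_mem_nhds (Metric.closedBall_mem_nhds _ hr') (Icc_mem_nhds (by linarith) hε₁))
  have hα0 : α (x₀, 0) = x₀ := (hα x₀ (Metric.mem_closedBall_self hr'.le)).1
  refine ⟨α, min ε₁ r, lt_min hε₁ hr', ?_, hca, ?_⟩
  · intro x hx
    have hx' := hα x (Metric.closedBall_subset_closedBall (min_le_right _ _) hx)
    have hsub : Icc (-(min ε₁ (r:ℝ))) (min ε₁ r) ⊆ Icc (-ε₁) ε₁ :=
      Icc_subset_Icc (neg_le_neg (min_le_left _ _)) (min_le_left _ _)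
    exact ⟨hx'.1, fun t ht => (hx'.2 t (hsub ht)).mono hsub⟩
  obtain ⟨N, hN, hNW⟩ := ric_nemytskii hW
  let c0 : C(unitInterval, E) := ContinuousMap.const _ x₀
  let cst : E →L[ℝ] C(unitInterval, E) := ContinuousLinearMap.const ℝ unitInterval
  have hcst : ∀ x, cst x = ContinuousMap.const _ x := fun x => rfl
  let G : (ℝ × E) × C(unitInterval, E) → C(unitInterval, E) :=
    fun v => v.2 - cst v.1.2 - v.1.1 • ricInt (N v.2)
  let u : (ℝ × E) × C(unitInterval, E) := ((0, x₀), c0)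
  have hGan : AnalyticAt ℝ G u := by
    have hN' : AnalyticAt ℝ (fun v : (ℝ × E) × C(unitInterval, E) => N v.2) u :=
      AnalyticAt.comp (g := N) (f := fun v : (ℝ × E) × C(unitInterval, E) => v.2) hN analyticAt_snd
    have hI : AnalyticAt ℝ (fun v : (ℝ × E) × C(unitInterval, E) => ricInt (N v.2)) u :=
      AnalyticAt.comp (g := fun y => (ricInt : C(unitInterval, E) →L[ℝ] _) y)
        (f := fun v : (ℝ × E) × C(unitInterval, E) => N v.2) (ContinuousLinearMap.analyticAt _ _) hN'
    have h1 : AnalyticAt ℝ (fun v : (ℝ × E) × C(unitInterval, E) => v.1.1) u :=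
      analyticAt_fst.comp analyticAt_fst
    have h2 : AnalyticAt ℝ (fun v : (ℝ × E) × C(unitInterval, E) => v.1.2) u :=
      analyticAt_snd.comp analyticAt_fst
    exact (analyticAt_snd.sub ((cst.analyticAt _).comp h2)).sub (h1.smul hI)
  have hGc : ContDiffAt ℝ ⊤ G u := hGan.contDiffAt
  have hder : fderiv ℝ G u ∘L ContinuousLinearMap.inr ℝ (ℝ × E) C(unitInterval, E)
      = ContinuousLinearMap.id ℝ _ := by
    have h1 : HasFDerivAt (fun y => G (u.1, y))
        (fderiv ℝ G u ∘L ContinuousLinearMap.inr ℝ (ℝ × E) C(unitInterval, E)) c0 := by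
      have h := hGan.differentiableAt.hasFDerivAt
      exact HasFDerivAt.comp c0 (g := G) (f := fun y => (u.1, y)) h (hasFDerivAt_prodMk_right _ _)
    have h2 : HasFDerivAt (fun y => G (u.1, y)) (ContinuousLinearMap.id ℝ _) c0 := by
      have : (fun y => G (u.1, y)) = fun y => y - cst x₀ := by
        ext1 y; simp [G, u]
      rw [this]
      exact (hasFDerivAt_id _).sub_const _
    exact h1.unique h2
  have hinv : (fderiv ℝ G u ∘L ContinuousLinearMap.inr ℝ (ℝ × E) C(unitInterval, E)).IsInvertible := by
    rw [hder]; exact ⟨ContinuousLinearEquiv.refl ℝ _, rfl⟩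
  have hne : (⊤ : WithTop ℕ∞) ≠ 0 := by simp
  have hg := hGc.contDiffAt_implicitFunction hne hinv
  have huniq := hGc.eventually_apply_eq_iff_implicitFunction hne hinv
  set g := hGc.implicitFunction hne hinv
  have hGu : G u = 0 := by
    ext s; simp [G, u, hcst, c0]
  have hgan : AnalyticAt ℝ g (0, x₀) := hg.analyticAt
  have hev : AnalyticAt ℝ (fun q => ContinuousMap.evalCLM ℝ (1 : unitInterval) (g q)) (0, x₀) :=
    (ContinuousLinearMap.analyticAt _ _).comp hgan
  refine hev.congr ?_
  -- the paths
  have hpath : ∀ δ > 0, ∀ᶠ q in 𝓝 ((0:ℝ), x₀), q.2 ∈ Metric.closedBall x₀ r ∧ |q.1| < ε₁ ∧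
      ∀ s ∈ Icc (0:ℝ) 1, dist (α (q.2, q.1 * s)) x₀ < δ := by
    intro δ hδ
    have h1 : ∀ᶠ z in 𝓝 (x₀, (0:ℝ)), dist (α z) x₀ < δ := by
      have := hca.tendsto
      rw [hα0] at this
      exact this (Metric.ball_mem_nhds _ hδ)
    obtain ⟨η, hη, hb⟩ := Metric.eventually_nhds_iff.1 h1
    have h2 : ∀ᶠ q in 𝓝 ((0:ℝ), x₀), dist q (0, x₀) < min η (min ε₁ r) :=
      Metric.ball_mem_nhds _ (lt_min hη (lt_min hε₁ hr'))
    filter_upwards [h2] with q hq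
    rw [Prod.dist_eq, max_lt_iff, lt_min_iff, lt_min_iff, lt_min_iff, lt_min_iff] at hq
    simp only [Real.dist_eq, sub_zero] at hq
    refine ⟨hq.2.2.2.le, hq.1.2.1, fun s hs => hb ?_⟩
    rw [Prod.dist_eq, max_lt_iff]
    refine ⟨hq.2.1, ?_⟩
    simp only [Real.dist_eq, sub_zero, abs_mul]
    rw [abs_of_nonneg hs.1]
    nlinarith [abs_nonneg q.1, hs.1, hs.2, hq.1.1]
  obtain ⟨δ, hδ, hb⟩ := Metric.eventually_nhds_iff.1 (huniq.and (hNW.prod_inr_nhds (0,x₀)))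
  filter_upwards [hpath (δ/2) (by positivity), Metric.ball_mem_nhds ((0:ℝ), x₀) hδ] with q hq hqb
  obtain ⟨hqr, hqε, hqs⟩ := hq
  have hαq := hα q.2 hqr
  have hin : ∀ s ∈ Icc (0:ℝ) 1, q.1 * s ∈ Ioo (-ε₁) ε₁ := by
    intro s hs
    rw [mem_Ioo, ← abs_lt, abs_mul, abs_of_nonneg hs.1]
    nlinarith [abs_nonneg q.1, hs.1, hs.2]
  have hd : ∀ s ∈ Icc (0:ℝ) 1, HasDerivAt (fun s => α (q.2, q.1 * s))
      (q.1 • W (α (q.2, q.1 * s))) s := by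
    intro s hs
    have h1 := (hαq.2 _ (Ioo_subset_Icc_self (hin s hs))).hasDerivAt
      (Icc_mem_nhds (hin s hs).1 (hin s hs).2)
    have h2 : HasDerivAt (fun s => q.1 * s) q.1 s := by simpa using (hasDerivAt_id s).const_mul q.1
    exact HasDerivAt.scomp s h1 h2
  let y : C(unitInterval, E) := ⟨fun s => α (q.2, q.1 * s), by
    rw [continuous_iff_continuousAt]
    intro s
    exact (hd s s.2).continuousAt.comp continuous_subtype_val.continuousAt⟩
  have hyd : dist y c0 < δ := by
    refine lt_of_le_of_lt ((ContinuousMap.dist_le (by positivity)).2 fun s => (hqs s s.2).le)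
      (by linarith)
  obtain ⟨h1, h2⟩ := hb (y := (q, y)) (by
    rw [Prod.dist_eq, max_lt_iff]; exact ⟨hqb, hyd⟩)
  have hGy : G (q, y) = G u := by
    rw [hGu]
    ext s
    have hs := s.2
    have hNc : Continuous (Set.IccExtend (zero_le_one' ℝ) (N y)) := (N y).continuous.Icc_extend'
    have key : ∫ σ in (0:ℝ)..s, q.1 • Set.IccExtend (zero_le_one' ℝ) (N y) σ
        = α (q.2, q.1 * s) - α (q.2, q.1 * 0) := by
      refine intervalIntegral.integral_eq_sub_of_hasDerivAt (f := fun s => α (q.2, q.1 * s)) ?_ ?_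
      · intro σ hσ
        rw [uIcc_of_le hs.1] at hσ
        have hσ1 : σ ∈ Icc (0:ℝ) 1 := ⟨hσ.1, hσ.2.trans hs.2⟩
        rw [Set.IccExtend_of_mem _ _ hσ1, h2]
        exact hd σ hσ1
      · exact (hNc.const_smul q.1).intervalIntegrable _ _
    rw [intervalIntegral.integral_smul] at key
    simp only [G, ContinuousMap.sub_apply, ContinuousMap.smul_apply, ricInt_apply, key, hcst]
    simp [y, hαq.1]
  have := h1.1 hGy
  simp only at this
  simp [this, y]

end RicA


section RicB
variable {E : Type*} [NormedAddCommGroup E] [NormedSpace ℝ E]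

/-- solution of the autonomous ODE on `[0,T]` inside `Ω` -/
def RicSol (W : E → E) (Ω : Set E) (x : E) (T : ℝ) (α : ℝ → E) : Prop :=
  α 0 = x ∧ ∀ t ∈ Icc (0:ℝ) T, α t ∈ Ω ∧ HasDerivWithinAt α (W (α t)) (Icc 0 T) t

lemma RicSol.mono {W : E → E} {Ω : Set E} {x : E} {T T' : ℝ} {α : ℝ → E}
    (h : RicSol W Ω x T α) (hT : T' ≤ T) : RicSol W Ω x T' α :=
  ⟨h.1, fun t ht => ⟨(h.2 t ⟨ht.1, ht.2.trans hT⟩).1,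
    (h.2 t ⟨ht.1, ht.2.trans hT⟩).2.mono (Icc_subset_Icc_right hT)⟩⟩

lemma RicSol.cont {W : E → E} {Ω : Set E} {x : E} {T : ℝ} {α : ℝ → E}
    (h : RicSol W Ω x T α) : ContinuousOn α (Icc 0 T) :=
  fun t ht => (h.2 t ht).2.continuousWithinAt

lemma ric_uniq [CompleteSpace E] {W : E → E} {Ω : Set E} (hW : AnalyticOnNhd ℝ W Ω)
    {x : E} {T : ℝ} {α β : ℝ → E} (hα : RicSol W Ω x T α) (hβ : RicSol W Ω x T β) :
    EqOn α β (Icc 0 T) := by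
  have hs : IsCompact (α '' Icc 0 T ∪ β '' Icc 0 T) :=
    (isCompact_Icc.image_of_continuousOn hα.cont).union
      (isCompact_Icc.image_of_continuousOn hβ.cont)
  have hsub : α '' Icc 0 T ∪ β '' Icc 0 T ⊆ Ω := by
    rintro _ (⟨t, ht, rfl⟩ | ⟨t, ht, rfl⟩)
    · exact (hα.2 t ht).1
    · exact (hβ.2 t ht).1
  have hL : LocallyLipschitzOn (α '' Icc 0 T ∪ β '' Icc 0 T) W := by
    intro y hy
    obtain ⟨K, t, ht, hl⟩ := ((hW y (hsub hy)).contDiffAt (n := 1)).exists_lipschitzOnWith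
    exact ⟨K, t, mem_nhdsWithin_of_mem_nhds ht, hl⟩
  obtain ⟨K, hK⟩ := hL.exists_lipschitzOnWith_of_compact hs
  refine ODE_solution_unique_of_mem_Icc_right (v := fun _ => W) (K := K)
    (s := fun _ => α '' Icc 0 T ∪ β '' Icc 0 T)
    (fun _ _ => hK) hα.cont ?_ ?_ hβ.cont ?_ ?_ (hα.1.trans hβ.1.symm)
  · intro t ht
    exact (hα.2 t (Ico_subset_Icc_self ht)).2.mono_of_mem_nhdsWithin (Icc_mem_nhdsGE_of_mem ht)
  · intro t ht; exact Or.inl (mem_image_of_mem _ (Ico_subset_Icc_self ht))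
  · intro t ht
    exact (hβ.2 t (Ico_subset_Icc_self ht)).2.mono_of_mem_nhdsWithin (Icc_mem_nhdsGE_of_mem ht)
  · intro t ht; exact Or.inr (mem_image_of_mem _ (Ico_subset_Icc_self ht))

/-- local analytic flow staying in `Ω`. -/
lemma ric_local_sol [CompleteSpace E] {W : E → E} {Ω : Set E} (hΩ : IsOpen Ω)
    (hW : AnalyticOnNhd ℝ W Ω) {y : E} (hy : y ∈ Ω) :
    ∃ β : E × ℝ → E, ∃ ε > (0:ℝ), (∀ x ∈ Metric.ball y ε, RicSol W Ω x ε (fun t => β (x, t))) ∧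
      (∀ x ∈ Metric.ball y ε, ∀ t, |t| < ε → AnalyticAt ℝ (fun q : ℝ × E => β (q.2, q.1)) (t, x)) := by
  obtain ⟨β, ε, hε, hβ, hc, han⟩ := ric_local_flow (hW y hy)
  have hβ0 : β (y, 0) = y := (hβ y (Metric.mem_closedBall_self hε.le)).1
  have h1 : ∀ᶠ z in 𝓝 (y, (0:ℝ)), β z ∈ Ω := by
    have := hc.tendsto
    rw [hβ0] at this
    exact this (hΩ.mem_nhds hy)
  obtain ⟨η, hη, hb⟩ := Metric.eventually_nhds_iff.1 h1
  obtain ⟨η', hη', hb'⟩ := Metric.eventually_nhds_iff.1 han.eventually_analyticAt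
  have hm : 0 < min ε (min (η/2) η') := lt_min hε (lt_min (by positivity) hη')
  refine ⟨β, min ε (min (η/2) η'), hm, ?_, ?_⟩
  · intro x hx
    rw [Metric.mem_ball, lt_min_iff, lt_min_iff] at hx
    have hx' := hβ x hx.1.le
    refine ⟨hx'.1, fun t ht => ⟨hb ?_, ?_⟩⟩
    · rw [Prod.dist_eq, max_lt_iff]
      refine ⟨by linarith [hx.2.1], ?_⟩
      simp only [Real.dist_eq, sub_zero]
      rw [abs_of_nonneg ht.1]
      have := (ht.2.trans (min_le_right _ _)).trans (min_le_left _ _)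
      linarith
    · have hsub : Icc 0 (min ε (min (η/2) η')) ⊆ Icc (-ε) ε :=
        Icc_subset_Icc (by linarith) (min_le_left _ _)
      exact (hx'.2 t (hsub ht)).mono hsub
  · intro x hx t ht
    rw [Metric.mem_ball, lt_min_iff, lt_min_iff] at hx
    rw [lt_min_iff, lt_min_iff] at ht
    apply hb'
    rw [Prod.dist_eq, max_lt_iff]
    refine ⟨?_, hx.2.2⟩
    simpa [Real.dist_eq] using ht.2.2

lemma ric_unif [CompleteSpace E] {W : E → E} {Ω : Set E} (hΩ : IsOpen Ω)
    (hW : AnalyticOnNhd ℝ W Ω) {C : Set E} (hC : IsCompact C) (hCΩ : C ⊆ Ω) :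
    ∃ ε > (0:ℝ), ∀ x ∈ C, ∃ α, RicSol W Ω x ε α := by
  refine hC.induction_on (p := fun s => ∃ ε > (0:ℝ), ∀ x ∈ s, ∃ α, RicSol W Ω x ε α)
    ⟨1, one_pos, by simp⟩ ?_ ?_ ?_
  · rintro s t hst ⟨ε, hε, h⟩
    exact ⟨ε, hε, fun x hx => h x (hst hx)⟩
  · rintro s t ⟨ε, hε, h⟩ ⟨ε', hε', h'⟩
    refine ⟨min ε ε', lt_min hε hε', ?_⟩
    rintro x (hx | hx)
    · obtain ⟨α, hα⟩ := h x hx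
      exact ⟨α, hα.mono (min_le_left _ _)⟩
    · obtain ⟨α, hα⟩ := h' x hx
      exact ⟨α, hα.mono (min_le_right _ _)⟩
  · intro y hy
    obtain ⟨β, ε, hε, h, -⟩ := ric_local_sol hΩ hW (hCΩ hy)
    exact ⟨_, mem_nhdsWithin_of_mem_nhds (Metric.ball_mem_nhds y hε), ε, hε,
      fun x hx => ⟨_, h x hx⟩⟩

lemma ric_glue {W : E → E} {Ω : Set E} {x : E} {T ε : ℝ} (hT : 0 ≤ T) (hε : 0 ≤ ε)
    {α β : ℝ → E} (hα : RicSol W Ω x T α) (hβ : RicSol W Ω (α T) ε β) :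
    ∃ γ, RicSol W Ω x (T + ε) γ := by
  let γ : ℝ → E := fun t => if t ≤ T then α t else β (t - T)
  have hγα : ∀ t ≤ T, γ t = α t := fun t ht => if_pos ht
  have hγβ : ∀ t, T ≤ t → γ t = β (t - T) := by
    intro t ht
    rcases ht.eq_or_lt with rfl | ht
    · simp [γ, hβ.1]
    · exact if_neg (not_le.2 ht)
  have hU : Icc 0 (T + ε) = Icc 0 T ∪ Icc T (T + ε) :=
    (Icc_union_Icc_eq_Icc hT (by linarith)).symm
  refine ⟨γ, (hγα 0 hT).trans hα.1, fun t ht => ?_⟩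
  have hd1 : ∀ t ∈ Icc 0 T, HasDerivWithinAt γ (W (γ t)) (Icc 0 T) t := by
    intro t ht
    rw [hγα t ht.2]
    exact (hα.2 t ht).2.congr (fun s hs => hγα s hs.2) (hγα t ht.2)
  have hd2 : ∀ t ∈ Icc T (T + ε), HasDerivWithinAt γ (W (γ t)) (Icc T (T + ε)) t := by
    intro t ht
    rw [hγβ t ht.1]
    have h1 := (hβ.2 (t - T) ⟨by linarith [ht.1], by linarith [ht.2]⟩).2
    have h2 : HasDerivWithinAt (fun s => s - T) 1 (Icc T (T + ε)) t :=
      ((hasDerivAt_id t).sub_const T).hasDerivWithinAt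
    have hm : MapsTo (fun s => s - T) (Icc T (T + ε)) (Icc 0 ε) := fun s hs =>
      ⟨sub_nonneg.2 hs.1, sub_le_iff_le_add'.2 hs.2⟩
    have h3 := HasDerivWithinAt.scomp t h1 h2 hm
    rw [one_smul] at h3
    exact h3.congr (fun s hs => hγβ s hs.1) (hγβ t ht.1)
  constructor
  · rcases le_total t T with h | h
    · rw [hγα t h]; exact (hα.2 t ⟨ht.1, h⟩).1
    · rw [hγβ t h]; exact (hβ.2 _ ⟨by linarith, by linarith [ht.2]⟩).1
  · rw [hU]
    rcases lt_trichotomy t T with h | h | h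
    · refine (hd1 t ⟨ht.1, h.le⟩).mono_of_mem_nhdsWithin ?_
      have : Iio T ∈ 𝓝 t := Iio_mem_nhds h
      filter_upwards [mem_nhdsWithin_of_mem_nhds this, self_mem_nhdsWithin] with s hs hs'
      rcases hs' with hs' | hs'
      · exact hs'
      · exact absurd hs'.1 (not_le.2 hs)
    · exact (hd1 t ⟨ht.1, h.le⟩).union (hd2 t ⟨h.ge, ht.2⟩)
    · refine (hd2 t ⟨h.le, ht.2⟩).mono_of_mem_nhdsWithin ?_
      have : Ioi T ∈ 𝓝 t := Ioi_mem_nhds h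
      filter_upwards [mem_nhdsWithin_of_mem_nhds this, self_mem_nhdsWithin] with s hs hs'
      rcases hs' with hs' | hs'
      · exact absurd hs'.2 (not_le.2 hs)
      · exact hs'

lemma ric_exist [CompleteSpace E] {W : E → E} {Ω : Set E} (hΩ : IsOpen Ω)
    (hW : AnalyticOnNhd ℝ W Ω) {x : E} (hx : x ∈ Ω) {T : ℝ} (hT : 0 ≤ T) {C : Set E}
    (hC : IsCompact C) (hCΩ : C ⊆ Ω)
    (hap : ∀ T', 0 ≤ T' → T' ≤ T → ∀ α, RicSol W Ω x T' α → α T' ∈ C) :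
    ∃ α, RicSol W Ω x T α := by
  obtain ⟨ε, hε, hloc⟩ := ric_unif hΩ hW hC hCΩ
  have key : ∀ n : ℕ, ∃ α, RicSol W Ω x (min T (n * ε)) α := by
    intro n
    induction n with
    | zero =>
      refine ⟨fun _ => x, rfl, fun t ht => ⟨hx, ?_⟩⟩
      have h0 : min T ((0:ℕ) * ε) = 0 := by simp [hT]
      rw [h0] at ht ⊢
      have : t = 0 := le_antisymm ht.2 ht.1
      subst this
      simp [hasDerivWithinAt_iff_hasFDerivWithinAt]
    | succ n ih =>
      obtain ⟨α, hα⟩ := ih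
      have h0 : 0 ≤ min T (n * ε) := le_min hT (by positivity)
      obtain ⟨β, hβ⟩ := hloc _ (hap _ h0 (min_le_left _ _) α hα)
      obtain ⟨γ, hγ⟩ := ric_glue h0 hε.le hα hβ
      refine ⟨γ, hγ.mono ?_⟩
      push_cast
      rcases le_total T (n * ε) with h | h
      · rw [min_eq_left h]; exact (min_le_left _ _).trans (by linarith)
      · rw [min_eq_right h]; exact (min_le_right _ _).trans (by linarith)
  obtain ⟨n, hn⟩ := exists_nat_ge (T / ε)
  obtain ⟨α, hα⟩ := key n
  rw [min_eq_left ((div_le_iff₀ hε).1 hn)] at hα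
  exact ⟨α, hα⟩

lemma ric_flow [CompleteSpace E] {W : E → E} {Ω : Set E} (hΩ : IsOpen Ω)
    (hW : AnalyticOnNhd ℝ W Ω)
    (hap : ∀ x ∈ Ω, ∀ T : ℝ, 0 ≤ T → ∃ C, IsCompact C ∧ C ⊆ Ω ∧
      ∀ T', 0 ≤ T' → T' ≤ T → ∀ α, RicSol W Ω x T' α → α T' ∈ C) :
    ∃ Ψ : ℝ → E → E, (∀ x ∈ Ω, ∀ T, 0 ≤ T → RicSol W Ω x T (fun t => Ψ t x)) ∧
      ∀ t, 0 ≤ t → ∀ x ∈ Ω, ∃ Φ : ℝ × E → E, AnalyticAt ℝ Φ (t, x) ∧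
        ∀ᶠ q in 𝓝 (t, x), 0 ≤ q.1 → Φ q = Ψ q.1 q.2 := by
  have hex : ∀ x ∈ Ω, ∀ T : ℝ, 0 ≤ T → ∃ α, RicSol W Ω x T α := by
    intro x hx T hT
    obtain ⟨C, hC, hCΩ, h⟩ := hap x hx T hT
    exact ric_exist hΩ hW hx hT hC hCΩ h
  choose! A hA using hex
  let Ψ : ℝ → E → E := fun t x => A x t t
  have hΨ : ∀ x ∈ Ω, ∀ T, 0 ≤ T → RicSol W Ω x T (fun t => Ψ t x) := by
    intro x hx T hT
    have heq : ∀ t ∈ Icc 0 T, Ψ t x = A x T t := fun t ht =>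
      ric_uniq hW (hA x hx t ht.1) ((hA x hx T hT).mono ht.2) ⟨ht.1, le_rfl⟩
    refine ⟨(hA x hx 0 le_rfl).1, fun t ht => ?_⟩
    have h := (hA x hx T hT).2 t ht
    simp only [heq t ht]
    exact ⟨h.1, h.2.congr heq (heq t ht)⟩
  have hΨ0 : ∀ x ∈ Ω, Ψ 0 x = x := fun x hx => (hΨ x hx 0 le_rfl).1
  have hmem : ∀ x ∈ Ω, ∀ t, 0 ≤ t → Ψ t x ∈ Ω := fun x hx t ht => ((hΨ x hx t ht).2 t ⟨ht, le_rfl⟩).1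
  have hadd : ∀ x ∈ Ω, ∀ s, 0 ≤ s → ∀ a, 0 ≤ a → Ψ (a + s) x = Ψ a (Ψ s x) := by
    intro x hx s hs a ha
    have h1 : RicSol W Ω (Ψ s x) a (fun r => Ψ (r + s) x) := by
      refine ⟨by simp, fun t ht => ⟨hmem x hx _ (by linarith [ht.1]), ?_⟩⟩
      have h1 := ((hΨ x hx (a + s) (by linarith)).2 (t + s) ⟨by linarith [ht.1], by linarith [ht.2]⟩).2
      have h2 : HasDerivWithinAt (fun r => r + s) 1 (Icc 0 a) t :=
        ((hasDerivAt_id t).add_const s).hasDerivWithinAt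
      have hm : MapsTo (fun r => r + s) (Icc 0 a) (Icc 0 (a + s)) := fun r hr =>
        ⟨add_nonneg hr.1 hs, add_le_add_left hr.2 s⟩
      have h3 := HasDerivWithinAt.scomp t h1 h2 hm
      rw [one_smul] at h3
      exact h3
    exact ric_uniq hW h1 (hΨ _ (hmem x hx s hs) a ha) ⟨ha, le_rfl⟩
  refine ⟨Ψ, hΨ, ?_⟩
  intro t₁ ht₁ x hx
  by_contra hcon
  let P : ℝ → Prop := fun t => ∃ Φ : ℝ × E → E, AnalyticAt ℝ Φ (t, x) ∧
        ∀ᶠ q in 𝓝 (t, x), 0 ≤ q.1 → Φ q = Ψ q.1 q.2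
  change ¬ P t₁ at hcon
  have hP0 : P 0 := by
    obtain ⟨β, ε, hε, hβ, hβa⟩ := ric_local_sol hΩ hW hx
    refine ⟨_, hβa x (Metric.mem_ball_self hε) 0 (by simpa using hε), ?_⟩
    filter_upwards [Metric.ball_mem_nhds ((0:ℝ), x) hε,
      continuous_snd.continuousAt.preimage_mem_nhds (hΩ.mem_nhds hx)] with q hq hqΩ hq0
    rw [Metric.mem_ball, Prod.dist_eq, max_lt_iff, Real.dist_eq, sub_zero, abs_of_nonneg hq0] at hq
    exact ric_uniq hW (hβ q.2 hq.2) (hΨ q.2 hqΩ ε hε.le) ⟨hq0, hq.1.le⟩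
  let S : Set ℝ := {t | 0 ≤ t ∧ ¬ P t}
  have hS : S.Nonempty := ⟨t₁, ht₁, hcon⟩
  have hSb : BddBelow S := ⟨0, fun t ht => ht.1⟩
  set t₀ := sInf S with ht₀
  have ht₀0 : 0 ≤ t₀ := le_csInf hS fun t ht => ht.1
  have hlow : ∀ s, 0 ≤ s → s < t₀ → P s := by
    intro s hs hst
    by_contra h
    exact absurd (csInf_le hSb (show s ∈ S from ⟨hs, h⟩)) (not_le.2 hst)
  obtain ⟨β, ε, hε, hβ, hβa⟩ := ric_local_sol hΩ hW (hmem x hx t₀ ht₀0)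
  -- continuity at t₀
  have hcont : ContinuousWithinAt (fun t => Ψ t x) (Icc 0 t₀) t₀ :=
    (hΨ x hx t₀ ht₀0).cont t₀ ⟨ht₀0, le_rfl⟩
  obtain ⟨δ, hδ, hδb⟩ := Metric.continuousWithinAt_iff.1 hcont ε hε
  set η := min (δ/2) (ε/4) with hη
  have hηpos : 0 < η := lt_min (by positivity) (by positivity)
  have hη1 : η ≤ δ/2 := min_le_left _ _
  have hη2 : η ≤ ε/4 := min_le_right _ _
  set s := max 0 (t₀ - η) with hs
  have hs0 : 0 ≤ s := le_max_left _ _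
  have hst : s ≤ t₀ := max_le ht₀0 (by linarith)
  have hst' : t₀ - η ≤ s := le_max_right _ _
  have hPs : P s := by
    rcases hs0.eq_or_lt with h | h
    · rw [← h]; exact hP0
    · apply hlow s hs0
      rcases max_choice 0 (t₀ - η) with h' | h'
      · rw [hs, h'] at h; exact absurd h (lt_irrefl _)
      · rw [hs, h']; linarith
  have hys : Ψ s x ∈ Metric.ball (Ψ t₀ x) ε :=
    hδb ⟨hs0, hst⟩ (by rw [Real.dist_eq, abs_sub_lt_iff]; constructor <;> linarith)
  obtain ⟨t, htS, htlt⟩ := exists_lt_of_csInf_lt hS (show sInf S < t₀ + η by linarith)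
  have htt : t₀ ≤ t := csInf_le hSb htS
  refine htS.2 ?_
  rcases eq_or_lt_of_le (hst.trans htt) with hEq | hlt
  · rw [← hEq]; exact hPs
  obtain ⟨Φ, hΦ, hΦe⟩ := hPs
  have hΦs : Φ (s, x) = Ψ s x := hΦe.self_of_nhds hs0
  have hincl : AnalyticAt ℝ (fun q : ℝ × E => Φ (s, q.2)) (t, x) :=
    AnalyticAt.comp (g := Φ) (f := fun q : ℝ × E => (s, q.2)) hΦ
      (analyticAt_const.prod analyticAt_snd)
  refine ⟨fun q => β (Φ (s, q.2), q.1 - s), ?_, ?_⟩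
  · have h1 : AnalyticAt ℝ (fun q : ℝ × E => (q.1 - s, Φ (s, q.2))) (t, x) :=
      (analyticAt_fst.sub analyticAt_const).prod hincl
    refine AnalyticAt.comp (g := fun q : ℝ × E => β (q.2, q.1)) ?_ h1
    simp only [hΦs]
    apply hβa _ hys
    rw [abs_of_nonneg (by linarith)]; linarith
  · have hc1 : ∀ᶠ q in 𝓝 (t, x), Φ (s, q.2) ∈ Metric.ball (Ψ t₀ x) ε := by
      apply hincl.continuousAt
      apply Metric.isOpen_ball.mem_nhds
      simpa only [hΦs] using hys
    have hc2 : ∀ᶠ q in 𝓝 (t, x), Φ (s, q.2) = Ψ s q.2 := by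
      have hm : Tendsto (fun q : ℝ × E => (s, q.2)) (𝓝 (t, x)) (𝓝 (s, x)) :=
        Continuous.tendsto (by fun_prop) _
      filter_upwards [hm.eventually hΦe] with q hq using hq hs0
    have hc3 : ∀ᶠ q : ℝ × E in 𝓝 (t, x), q.1 ∈ Ioo s (t₀ + η) :=
      continuous_fst.continuousAt.preimage_mem_nhds (Ioo_mem_nhds hlt htlt)
    have hc4 : ∀ᶠ q : ℝ × E in 𝓝 (t, x), q.2 ∈ Ω :=
      continuous_snd.continuousAt.preimage_mem_nhds (hΩ.mem_nhds hx)
    filter_upwards [hc1, hc2, hc3, hc4] with q h1 h2 h3 h4 _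
    have h5 := hadd q.2 h4 s hs0 (q.1 - s) (by linarith [h3.1])
    rw [sub_add_cancel] at h5
    rw [h5, ← h2]
    rw [h2] at h1 ⊢
    exact ric_uniq hW (hβ _ h1) (hΨ _ (hmem q.2 h4 s hs0) ε hε.le)
      ⟨by linarith [h3.1], by linarith [h3.2]⟩

end RicB


lemma ric_analytic_integral {α E : Type*} [MeasurableSpace α] {μ : Measure α}
    [NormedAddCommGroup E] [NormedSpace ℝ E] (p : α → FormalMultilinearSeries ℝ E ℝ)
    (f : E → α → ℝ) (G : α → ℝ) (r : NNReal) (hr : 0 < r)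
    (hm : ∀ n, AEStronglyMeasurable (fun a => p a n) μ) (hG : Integrable G μ)
    (hb : ∀ᵐ a ∂μ, ∀ n, ‖p a n‖ * (r:ℝ) ^ n ≤ (1/2) ^ n * G a)
    (hf : ∀ᵐ a ∂μ, ∀ h : E, ‖h‖ < r → HasSum (fun n => p a n (fun _ => h)) (f h a)) :
    AnalyticAt ℝ (fun h => ∫ a, f h a ∂μ) 0 := by
  have hr0 : (0:ℝ) < r := hr
  have hpi : ∀ n, Integrable (fun a => p a n) μ := by
    intro n
    refine (hG.const_mul ((1/2)^n * ((r:ℝ)^n)⁻¹)).mono' (hm n) ?_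
    filter_upwards [hb] with a ha
    have h2 : 0 < (r:ℝ)^n := by positivity
    have h1 := (le_div_iff₀ h2).2 (ha n)
    calc _ ≤ _ := h1
      _ = _ := by rw [div_eq_mul_inv]; ring
  refine ⟨fun n => ∫ a, p a n ∂μ, r, ?_, by exact_mod_cast hr, ?_⟩
  · refine FormalMultilinearSeries.le_radius_of_bound _ (∫ a, |G a| ∂μ) (fun n => ?_)
    have h1 : ‖∫ a, p a n ∂μ‖ ≤ ∫ a, ‖p a n‖ ∂μ := norm_integral_le_integral_norm _
    calc ‖∫ a, p a n ∂μ‖ * (r:ℝ)^n ≤ (∫ a, ‖p a n‖ ∂μ) * (r:ℝ)^n := by gcongr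
      _ = ∫ a, ‖p a n‖ * (r:ℝ)^n ∂μ := (integral_mul_const _ _).symm
      _ ≤ _ := by
        refine integral_mono_ae ((hpi n).norm.mul_const _) hG.abs ?_
        filter_upwards [hb] with a ha
        refine (ha n).trans ?_
        have : ((1:ℝ)/2)^n ≤ 1 := pow_le_one₀ (by norm_num) (by norm_num)
        have h3 : (0:ℝ) ≤ (1/2)^n := by positivity
        nlinarith [le_abs_self (G a), abs_nonneg (G a)]
  · intro h hh
    rw [zero_add]
    have hh' : ‖h‖ < r := by
      simpa [Metric.mem_eball, edist_zero_right, enorm_eq_nnnorm] using hh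
    have := hasSum_integral_of_dominated_convergence (μ := μ)
      (F := fun n a => p a n (fun _ => h)) (f := f h) (fun n a => (1/2)^n * |G a|)
      (fun n => (ContinuousMultilinearMap.apply ℝ (fun _ : Fin n => E) ℝ (fun _ => h)).continuous.comp_aestronglyMeasurable (hm n))
      ?_ ?_ ?_ ?_
    · convert this using 2 with n
      exact ((ContinuousMultilinearMap.apply ℝ (fun _ : Fin n => E) ℝ (fun _ => h)).integral_comp_comm (hpi n)).symm
    · intro n
      filter_upwards [hb] with a ha
      refine ((p a n).le_opNorm _).trans ?_
      simp only [Finset.prod_const, Finset.card_univ, Fintype.card_fin]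
      calc ‖p a n‖ * ‖h‖^n ≤ ‖p a n‖ * (r:ℝ)^n := by gcongr
        _ ≤ _ := ha n
        _ ≤ _ := by gcongr; exact le_abs_self _
    · exact Eventually.of_forall fun a => (summable_geometric_of_lt_one (by norm_num) (by norm_num)).mul_right _
    · simp_rw [tsum_mul_right]
      exact hG.abs.const_mul _
    · filter_upwards [hf] with a ha using ha h hh'

lemma ric_exp_aux {y : ℝ} (hy : 0 ≤ y) {n : ℕ} (hn : 2 ≤ n) :
    y ^ n / (n.factorial : ℝ) ≤ y ^ 2 * Real.exp y := by
  obtain ⟨k, rfl⟩ := Nat.exists_eq_add_of_le hn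
  have h1 : y ^ k / (k.factorial : ℝ) ≤ Real.exp y := Real.pow_div_factorial_le_exp y hy k
  have h2 : ((k.factorial : ℕ) : ℝ) ≤ ((2 + k).factorial : ℝ) := by
    exact_mod_cast Nat.factorial_le (by omega)
  have h3 : (0:ℝ) < k.factorial := by exact_mod_cast Nat.factorial_pos k
  calc y ^ (2 + k) / ((2 + k).factorial : ℝ) ≤ y ^ (2 + k) / (k.factorial : ℝ) := by gcongr
    _ = y ^ 2 * (y ^ k / (k.factorial : ℝ)) := by rw [pow_add]; ring
    _ ≤ _ := by gcongr

lemma ric_min_aux {a b z : ℝ} (hz : 0 ≤ z) (ha : 0 ≤ a) (hb : 0 ≤ b) {y : ℝ} (h1 : y ≤ a * z) (h2 : y ≤ b) :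
    y ≤ (a + b) * min z 1 := by
  rcases le_total z 1 with h | h
  · rw [min_eq_left h]
    nlinarith
  · rw [min_eq_right h]; nlinarith

lemma ric_exp_aux2 {a c z : ℝ} (hz : 0 ≤ z) (hc : 0 < c) {s : ℝ} (hs : c * z ≤ s) (hsa : s ≤ a * z)
    (ha : 0 ≤ a) {n : ℕ} (hn : 2 ≤ n) :
    Real.exp (-s) * (c / 4 * z) ^ n / (n.factorial : ℝ) ≤ (1/2) ^ n * ((a ^ 2 + 2) * min (z ^ 2) 1) := by
  have hs0 : 0 ≤ s := le_trans (by positivity) hs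
  have h1 := ric_exp_aux (y := s / 2) (by positivity) hn
  have e1 : Real.exp (-s) * Real.exp (s/2) = Real.exp (-(s/2)) := by
    rw [← Real.exp_add]; ring_nf
  have e2 : Real.exp (-s) * ((s/2) ^ n / (n.factorial : ℝ)) ≤ (s/2)^2 * Real.exp (-(s/2)) := by
    calc _ ≤ Real.exp (-s) * ((s/2)^2 * Real.exp (s/2)) := by gcongr
      _ = (s/2)^2 * (Real.exp (-s) * Real.exp (s/2)) := by ring
      _ = _ := by rw [e1]
  have e3 : Real.exp (-(s/2)) ≤ 1 := Real.exp_le_one_iff.2 (by linarith)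
  have e4 : (s/2)^2 * Real.exp (-(s/2)) ≤ (a^2 + 2) * min (z^2) 1 := by
    refine ric_min_aux (by positivity) (by positivity) (by norm_num) ?_ ?_
    · calc _ ≤ (s/2)^2 * 1 := by gcongr
        _ ≤ (a * z)^2 := by rw [mul_one]; gcongr; linarith
        _ = _ := by ring
    · rw [Real.exp_neg, ← div_eq_mul_inv, div_le_iff₀ (Real.exp_pos _)]
      have := Real.quadratic_le_exp_of_nonneg (x := s/2) (by positivity)
      nlinarith
  calc Real.exp (-s) * (c / 4 * z) ^ n / (n.factorial : ℝ)
      ≤ Real.exp (-s) * (s / 2 / 2) ^ n / (n.factorial : ℝ) := by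
        gcongr
        linarith
    _ = (1/2)^n * (Real.exp (-s) * ((s/2) ^ n / (n.factorial : ℝ))) := by
        rw [div_pow (s/2), one_div, inv_pow]; ring
    _ ≤ _ := mul_le_mul_of_nonneg_left (e2.trans e4) (by positivity)

section
set_option linter.unusedSectionVars false
variable {V : Type*} [NormedAddCommGroup V] [InnerProductSpace ℝ V] [FiniteDimensional ℝ V]
  [MeasurableSpace V] [BorelSpace V]

/-- power series coefficients -/
noncomputable def ricSer (u0 : V) (ξ : V) : FormalMultilinearSeries ℝ V ℝ := fun n =>
  (if n < 2 then 0 else Real.exp (-⟪u0, ξ⟫) / (n.factorial : ℝ)) •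
    (ContinuousMultilinearMap.mkPiAlgebraFin ℝ n ℝ).compContinuousLinearMap
      (fun _ => innerSL ℝ (-ξ))

lemma ricSer_apply (u0 ξ h : V) (n : ℕ) : ricSer u0 ξ n (fun _ => h) =
    (if n < 2 then 0 else Real.exp (-⟪u0, ξ⟫) / (n.factorial : ℝ)) * (-⟪h, ξ⟫) ^ n := by
  unfold ricSer
  rw [ContinuousMultilinearMap.smul_apply, ContinuousMultilinearMap.compContinuousLinearMap_apply,
    ContinuousMultilinearMap.mkPiAlgebraFin_apply, List.ofFn_const, List.prod_replicate,
    innerSL_apply_apply, inner_neg_left, real_inner_comm h ξ, smul_eq_mul]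

lemma ricSer_cont (u0 : V) (n : ℕ) : Continuous (fun ξ => ricSer u0 ξ n) := by
  unfold ricSer
  have hc : Continuous (fun ξ : V => if n < 2 then (0:ℝ) else Real.exp (-⟪u0, ξ⟫) / (n.factorial : ℝ)) := by
    split_ifs <;> fun_prop
  refine hc.smul (M := ℝ) ?_
  · have h1 := ((ContinuousMultilinearMap.compContinuousLinearMapContinuousMultilinear ℝ
      (fun _ : Fin n => V) (fun _ : Fin n => ℝ) ℝ)).cont
    have h2 : Continuous (fun ξ : V => (fun _ : Fin n => innerSL ℝ (-ξ))) := by fun_prop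
    have h3 := (h1.comp h2).clm_apply (continuous_const (y := ContinuousMultilinearMap.mkPiAlgebraFin ℝ n ℝ))
    exact h3

lemma ricSer_norm (u0 ξ : V) (n : ℕ) : ‖ricSer u0 ξ n‖ ≤
    (if n < 2 then 0 else Real.exp (-⟪u0, ξ⟫) / (n.factorial : ℝ)) * ‖ξ‖ ^ n := by
  unfold ricSer
  rw [norm_smul]
  have h := ContinuousMultilinearMap.norm_compContinuousLinearMap_le
    (ContinuousMultilinearMap.mkPiAlgebraFin ℝ n ℝ) (fun _ => innerSL ℝ (-ξ))
  rw [ContinuousMultilinearMap.norm_mkPiAlgebraFin] at h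
  simp only [innerSL_apply_norm, norm_neg, Finset.prod_const, Finset.card_univ, Fintype.card_fin, one_mul] at h
  have h0 : 0 ≤ (if n < 2 then 0 else Real.exp (-⟪u0, ξ⟫) / (n.factorial : ℝ)) := by
    split_ifs <;> positivity
  rw [Real.norm_of_nonneg h0]
  gcongr

lemma ric_hasSum (w x : ℝ) : HasSum (fun n : ℕ => (if n < 2 then 0 else w / (n.factorial : ℝ)) * x ^ n)
    (w * (Real.exp x - 1 - x)) := by
  have h1 : HasSum (fun n : ℕ => x ^ n / (n.factorial : ℝ)) (Real.exp x) := by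
    have := NormedSpace.expSeries_div_hasSum_exp (𝔸 := ℝ) x
    rwa [← Real.exp_eq_exp_ℝ] at this
  have h2 := (hasSum_nat_add_iff' 2).2 h1
  have h3 : HasSum (fun n : ℕ => (if n + 2 < 2 then 0 else w / ((n+2).factorial : ℝ)) * x ^ (n+2))
      (w * (Real.exp x - 1 - x)) := by
    have e1 : (fun n : ℕ => (if n + 2 < 2 then 0 else w / ((n+2).factorial : ℝ)) * x ^ (n+2)) =
        fun n : ℕ => w * (x ^ (n+2) / ((n+2).factorial : ℝ)) := by
      funext n
      rw [if_neg (by omega)]; ring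
    have e2 : w * (Real.exp x - 1 - x) = w * (Real.exp x - ∑ i ∈ Finset.range 2, x ^ i / (i.factorial : ℝ)) := by
      simp [Finset.sum_range_succ, sub_sub]
    rw [e1, e2]
    exact h2.mul_left w
  have := (hasSum_nat_add_iff (f := fun n : ℕ => (if n < 2 then 0 else w / (n.factorial : ℝ)) * x ^ n) 2).1 h3
  simpa [Finset.sum_range_succ] using this

lemma ric_I2 {K : Set V} {μ : Measure V} (hμ : μ Kᶜ = 0)
    (hJ : Integrable (fun ξ => min (‖ξ‖ ^ 2) 1) μ) {u0 : V} {c : ℝ} (hc : 0 < c)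
    (hu : ∀ ξ ∈ K, c * ‖ξ‖ ≤ ⟪u0, ξ⟫) :
    AnalyticAt ℝ (fun h : V => ∫ ξ, Real.exp (-⟪u0, ξ⟫) * (Real.exp (-⟪h, ξ⟫) - 1 + ⟪h, ξ⟫) ∂μ) 0 := by
  have hK : ∀ᵐ ξ ∂μ, ξ ∈ K := by rw [ae_iff]; exact hμ
  refine ric_analytic_integral (ricSer u0) _ (fun ξ => (‖u0‖ ^ 2 + 2) * min (‖ξ‖ ^ 2) 1)
    ⟨c / 4, by positivity⟩ (by show (0:ℝ) < c / 4; positivity)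
    (fun n => (ricSer_cont u0 n).aestronglyMeasurable) (hJ.const_mul _) ?_ ?_
  · filter_upwards [hK] with ξ hξ n
    show _ * (c / 4) ^ n ≤ _
    refine (mul_le_mul_of_nonneg_right (ricSer_norm u0 ξ n) (by positivity)).trans ?_
    split_ifs with h
    · rw [zero_mul, zero_mul]; positivity
    · refine le_trans (le_of_eq ?_) (ric_exp_aux2 (norm_nonneg ξ) hc (hu ξ hξ) (real_inner_le_norm u0 ξ)
        (norm_nonneg _) (not_lt.1 h))
      rw [mul_pow]; ring
  · filter_upwards with ξ h _
    simp_rw [ricSer_apply]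
    convert ric_hasSum (Real.exp (-⟪u0, ξ⟫)) (-⟪h, ξ⟫) using 1
    ring

lemma ric_k_bound {χ : V → V} (hχ1 : ∀ ξ, ‖χ ξ‖ ≤ 1) {δ : ℝ} (hδ : 0 < δ) (hδ1 : δ ≤ 1)
    (hχ : ∀ ξ, ‖ξ‖ < δ → χ ξ = ξ) {u ξ : V} (hu : 0 ≤ ⟪u, ξ⟫) :
    -((1 + ‖u‖) / δ ^ 2) * min (‖ξ‖ ^ 2) 1 ≤ Real.exp (-⟪u, ξ⟫) - 1 + ⟪χ ξ, u⟫ ∧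
    Real.exp (-⟪u, ξ⟫) - 1 + ⟪χ ξ, u⟫ ≤ (‖u‖ ^ 2 + ‖u‖ / δ ^ 2) * min (‖ξ‖ ^ 2) 1 := by
  rcases lt_or_ge ‖ξ‖ δ with h | h
  · rw [hχ ξ h, real_inner_comm u ξ]
    have hm : min (‖ξ‖ ^ 2) 1 = ‖ξ‖ ^ 2 := min_eq_left (pow_le_one₀ (norm_nonneg _) (h.le.trans hδ1))
    rw [hm]
    set s := ⟪u, ξ⟫
    have h1 := Real.add_one_le_exp (-s)
    have h2 : Real.exp (-s) ≤ 1 - s + s ^ 2 := by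
      rw [Real.exp_neg, inv_le_comm₀ (Real.exp_pos _) (by nlinarith)]
      refine le_trans ?_ (Real.add_one_le_exp s)
      rw [inv_le_iff_one_le_mul₀ (by nlinarith)]
      nlinarith [pow_nonneg hu 3]
    have h3 : s ≤ ‖u‖ * ‖ξ‖ := real_inner_le_norm u ξ
    have h4 : s ^ 2 ≤ ‖u‖ ^ 2 * ‖ξ‖ ^ 2 := by rw [← mul_pow]; gcongr
    have h5 : 0 ≤ (1 + ‖u‖) / δ ^ 2 * ‖ξ‖ ^ 2 := by positivity
    have h6 : 0 ≤ ‖u‖ / δ ^ 2 * ‖ξ‖ ^ 2 := by positivity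
    constructor <;> nlinarith
  · have hm : δ ^ 2 ≤ min (‖ξ‖ ^ 2) 1 := le_min (by gcongr) (pow_le_one₀ hδ.le hδ1)
    have h1 : |⟪χ ξ, u⟫| ≤ ‖u‖ := by
      refine (abs_real_inner_le_norm _ _).trans ?_
      nlinarith [hχ1 ξ, norm_nonneg u]
    have h2 := abs_le.1 h1
    have h3 : Real.exp (-⟪u, ξ⟫) ≤ 1 := Real.exp_le_one_iff.2 (by linarith)
    have h4 := Real.exp_pos (-⟪u, ξ⟫)
    have h5 : (1 + ‖u‖) / δ ^ 2 * δ ^ 2 ≤ (1 + ‖u‖) / δ ^ 2 * min (‖ξ‖ ^ 2) 1 := by gcongr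
    have h6 : ‖u‖ / δ ^ 2 * δ ^ 2 ≤ ‖u‖ / δ ^ 2 * min (‖ξ‖ ^ 2) 1 := by gcongr
    rw [div_mul_cancel₀ _ (by positivity)] at h5 h6
    have h7 : 0 ≤ ‖u‖ ^ 2 * min (‖ξ‖ ^ 2) 1 := by positivity
    constructor <;> nlinarith

lemma ric_k_integrable {K : Set V} {χ : V → V} (hχc : Continuous χ) (hχ1 : ∀ ξ, ‖χ ξ‖ ≤ 1) {δ : ℝ} (hδ : 0 < δ) (hδ1 : δ ≤ 1)
    (hχ : ∀ ξ, ‖ξ‖ < δ → χ ξ = ξ) {μ : Measure V} (hμ : μ Kᶜ = 0)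
    (hJ : Integrable (fun ξ => min (‖ξ‖ ^ 2) 1) μ) {u : V} (hu : ∀ ξ ∈ K, 0 ≤ ⟪u, ξ⟫) :
    Integrable (fun ξ => Real.exp (-⟪u, ξ⟫) - 1 + ⟪χ ξ, u⟫) μ := by
  have hK : ∀ᵐ ξ ∂μ, ξ ∈ K := by rw [ae_iff]; exact hμ
  refine (hJ.const_mul ((1 + ‖u‖) / δ ^ 2 + (‖u‖ ^ 2 + ‖u‖ / δ ^ 2))).mono' ?_ ?_
  · have : Continuous (fun ξ => Real.exp (-⟪u, ξ⟫) - 1 + ⟪χ ξ, u⟫) := by fun_prop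
    exact this.aestronglyMeasurable
  · filter_upwards [hK] with ξ hξ
    obtain ⟨h1, h2⟩ := ric_k_bound hχ1 hδ hδ1 hχ (hu ξ hξ)
    have h3 : 0 ≤ (1 + ‖u‖) / δ ^ 2 * min (‖ξ‖ ^ 2) 1 := by positivity
    have h4 : 0 ≤ (‖u‖ ^ 2 + ‖u‖ / δ ^ 2) * min (‖ξ‖ ^ 2) 1 := by positivity
    rw [Real.norm_eq_abs, abs_le]
    constructor <;> nlinarith

lemma ric_I_analytic {K : Set V} {χ : V → V} (hχc : Continuous χ) (hχ1 : ∀ ξ, ‖χ ξ‖ ≤ 1) {δ : ℝ} (hδ : 0 < δ) (hδ1 : δ ≤ 1)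
    (hχ : ∀ ξ, ‖ξ‖ < δ → χ ξ = ξ) {μ : Measure V} (hμ : μ Kᶜ = 0)
    (hJ : Integrable (fun ξ => min (‖ξ‖ ^ 2) 1) μ) {u0 : V} {c : ℝ} (hc : 0 < c)
    (hu : ∀ ξ ∈ K, c * ‖ξ‖ ≤ ⟪u0, ξ⟫) :
    AnalyticAt ℝ (fun u : V => ∫ ξ, (Real.exp (-⟪u, ξ⟫) - 1 + ⟪χ ξ, u⟫) ∂μ) u0 := by
  have hK : ∀ᵐ ξ ∂μ, ξ ∈ K := by rw [ae_iff]; exact hμ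
  set w : V → ℝ := fun ξ => Real.exp (-⟪u0, ξ⟫) with hw
  have hwc : Continuous w := by rw [hw]; fun_prop
  have hvi : Integrable (fun ξ => χ ξ - w ξ • ξ) μ := by
    refine (hJ.const_mul (‖u0‖ + (1 + 1 / c) / δ ^ 2)).mono'
      (hχc.sub (hwc.smul continuous_id)).aestronglyMeasurable ?_
    filter_upwards [hK] with ξ hξ
    have hs0 : 0 ≤ ⟪u0, ξ⟫ := le_trans (by positivity) (hu ξ hξ)
    have hw1 : w ξ ≤ 1 := Real.exp_le_one_iff.2 (by linarith)
    have hw0 : 0 < w ξ := Real.exp_pos _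
    have hp1 : 0 ≤ ‖u0‖ * min (‖ξ‖ ^ 2) 1 := by positivity
    have hp2 : 0 ≤ (1 + 1 / c) / δ ^ 2 * min (‖ξ‖ ^ 2) 1 := by positivity
    rw [add_mul]
    rcases lt_or_ge ‖ξ‖ δ with h | h
    · have hm : min (‖ξ‖ ^ 2) 1 = ‖ξ‖ ^ 2 := min_eq_left (pow_le_one₀ (norm_nonneg _) (h.le.trans hδ1))
      have e : χ ξ - w ξ • ξ = (1 - w ξ) • ξ := by rw [hχ ξ h, sub_smul, one_smul]
      rw [e, norm_smul, Real.norm_of_nonneg (by linarith)]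
      have h1 := Real.add_one_le_exp (-⟪u0, ξ⟫)
      have h3 : ⟪u0, ξ⟫ ≤ ‖u0‖ * ‖ξ‖ := real_inner_le_norm u0 ξ
      have h4 : 1 - w ξ ≤ ‖u0‖ * ‖ξ‖ := by simp only [hw]; linarith
      rw [hm] at hp2 ⊢
      nlinarith [norm_nonneg ξ]
    · have hm : δ ^ 2 ≤ min (‖ξ‖ ^ 2) 1 := le_min (by gcongr) (pow_le_one₀ hδ.le hδ1)
      have h5 : (1 + 1 / c) / δ ^ 2 * δ ^ 2 ≤ (1 + 1 / c) / δ ^ 2 * min (‖ξ‖ ^ 2) 1 := by gcongr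
      rw [div_mul_cancel₀ _ (by positivity)] at h5
      have h6 : ‖w ξ • ξ‖ ≤ 1 / c := by
        rw [norm_smul, Real.norm_of_nonneg hw0.le, le_div_iff₀ hc]
        have h7 : ‖ξ‖ * c ≤ Real.exp ⟪u0, ξ⟫ := by
          linarith [hu ξ hξ, Real.add_one_le_exp ⟪u0, ξ⟫]
        simp only [hw]
        rw [Real.exp_neg, mul_assoc, inv_mul_le_iff₀ (Real.exp_pos _), mul_one]
        exact h7
      linarith [norm_sub_le (χ ξ) (w ξ • ξ), hχ1 ξ]
  have h0 : Integrable (fun ξ => w ξ - 1 + ⟪χ ξ, u0⟫) μ :=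
    ric_k_integrable hχc hχ1 hδ hδ1 hχ hμ hJ (fun ξ hξ => le_trans (by positivity) (hu ξ hξ))
  have hA := ric_I2 hμ hJ hc hu
  have hsub : AnalyticAt ℝ (fun u : V => u - u0) u0 := analyticAt_id.sub analyticAt_const
  have hA' : AnalyticAt ℝ (fun u : V => ∫ ξ, w ξ * (Real.exp (-⟪u - u0, ξ⟫) - 1 + ⟪u - u0, ξ⟫) ∂μ) u0 :=
    AnalyticAt.fun_comp (g := fun h : V => ∫ ξ, w ξ * (Real.exp (-⟪h, ξ⟫) - 1 + ⟪h, ξ⟫) ∂μ)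
      (by rw [sub_self]; exact hA) hsub
  have hB : AnalyticAt ℝ (fun u : V => ⟪∫ ξ, (χ ξ - w ξ • ξ) ∂μ, u - u0⟫) u0 :=
    ((innerSL ℝ (∫ ξ, (χ ξ - w ξ • ξ) ∂μ)).analyticAt _).fun_comp hsub
  refine ((hA'.add hB).add (analyticAt_const (v := ∫ ξ, (w ξ - 1 + ⟪χ ξ, u0⟫) ∂μ))).congr ?_
  filter_upwards [Metric.ball_mem_nhds u0 hc] with u hub
  have hk : Integrable (fun ξ => Real.exp (-⟪u, ξ⟫) - 1 + ⟪χ ξ, u⟫) μ := by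
    refine ric_k_integrable hχc hχ1 hδ hδ1 hχ hμ hJ (fun ξ hξ => ?_)
    have h1 : ⟪u, ξ⟫ = ⟪u0, ξ⟫ + ⟪u - u0, ξ⟫ := by rw [← inner_add_left]; congr 1; abel
    have h2 := (abs_le.1 (abs_real_inner_le_norm (u - u0) ξ)).1
    rw [Metric.mem_ball, dist_eq_norm] at hub
    nlinarith [hu ξ hξ, norm_nonneg ξ]
  have hv : Integrable (fun ξ => ⟪χ ξ - w ξ • ξ, u - u0⟫) μ := hvi.inner_const _
  have hv2 : ∫ ξ, ⟪χ ξ - w ξ • ξ, u - u0⟫ ∂μ = ⟪∫ ξ, (χ ξ - w ξ • ξ) ∂μ, u - u0⟫ := by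
    simp_rw [real_inner_comm (u - u0)]
    exact integral_inner hvi _
  have hpt : ∀ ξ, w ξ * (Real.exp (-⟪u - u0, ξ⟫) - 1 + ⟪u - u0, ξ⟫) =
      (Real.exp (-⟪u, ξ⟫) - 1 + ⟪χ ξ, u⟫) - ⟪χ ξ - w ξ • ξ, u - u0⟫ - (w ξ - 1 + ⟪χ ξ, u0⟫) := by
    intro ξ
    have e1 : Real.exp (-⟪u, ξ⟫) = w ξ * Real.exp (-⟪u - u0, ξ⟫) := by
      simp only [hw]
      rw [← Real.exp_add, inner_sub_left]; ring_nf
    have e2 : ⟪χ ξ - w ξ • ξ, u - u0⟫ = ⟪χ ξ, u⟫ - ⟪χ ξ, u0⟫ - w ξ * ⟪u - u0, ξ⟫ := by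
      rw [inner_sub_left, inner_sub_right, real_inner_smul_left, real_inner_comm ξ (u - u0)]
    rw [e1, e2]
    ring
  simp only [Pi.add_apply]
  simp_rw [hpt]
  have e3 := integral_sub (hk.sub hv) h0
  simp only [Pi.sub_apply] at e3
  rw [e3, integral_sub hk hv, hv2]
  ring
end


section
set_option linter.unusedSectionVars false
variable {V : Type*} [NormedAddCommGroup V] [InnerProductSpace ℝ V] [FiniteDimensional ℝ V]
  [MeasurableSpace V] [BorelSpace V]

lemma ric_zero_mem {K : Set V} (hK : IsProperConvexCone K) : (0:V) ∈ K := by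
  obtain ⟨x, hx, _⟩ := hK.generating 0
  simpa using hK.smul_mem 0 le_rfl x hx

lemma ric_add_mem {K : Set V} (hK : IsProperConvexCone K) {x y : V} (hx : x ∈ K) (hy : y ∈ K) :
    x + y ∈ K := by
  have h := hK.convex hx hy (a := 1/2) (b := 1/2) (by norm_num) (by norm_num) (by norm_num)
  have h2 := hK.smul_mem 2 (by norm_num) _ h
  rw [← smul_add, smul_smul] at h2
  norm_num at h2
  exact h2

lemma ric_interior {K : Set V} (hK : IsProperConvexCone K) : (interior K).Nonempty := by
  rw [hK.convex.interior_nonempty_iff_affineSpan_eq_top,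
    AffineSubspace.affineSpan_eq_top_iff_vectorSpan_eq_top_of_nonempty _ _ _ ⟨0, ric_zero_mem hK⟩,
    eq_top_iff]
  intro v _
  obtain ⟨x, hx, y, hy, rfl⟩ := hK.generating v
  exact vsub_mem_vectorSpan ℝ hx hy

lemma ric_strict {S : Set V} {x0 : V} (hx : x0 ∈ interior S) :
    ∃ r > 0, ∀ u : V, (∀ x ∈ S, 0 ≤ ⟪x, u⟫) → r * ‖u‖ ≤ ⟪x0, u⟫ := by
  obtain ⟨ρ, hρ, hb⟩ := Metric.isOpen_iff.1 isOpen_interior x0 hx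
  refine ⟨ρ / 2, by positivity, fun u hu => ?_⟩
  rcases eq_or_ne u 0 with rfl | h0
  · simp
  have hn : 0 < ‖u‖ := norm_pos_iff.2 h0
  have hm : x0 - (ρ / 2 / ‖u‖) • u ∈ S := by
    apply interior_subset (hb _)
    rw [Metric.mem_ball, dist_eq_norm, sub_sub_cancel_left, norm_neg, norm_smul,
      Real.norm_of_nonneg (by positivity), div_mul_cancel₀ _ hn.ne']
    linarith
  have := hu _ hm
  rw [inner_sub_left, real_inner_smul_left, real_inner_self_eq_norm_sq] at this
  have e : ρ / 2 / ‖u‖ * ‖u‖ ^ 2 = ρ / 2 * ‖u‖ := by field_simp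
  linarith

lemma ric_dual_strict {K : Set V} {u : V} (hu : u ∈ interior (dualCone K)) :
    ∃ c > 0, ∀ x ∈ K, c * ‖x‖ ≤ ⟪u, x⟫ := by
  obtain ⟨r, hr, h⟩ := ric_strict hu
  refine ⟨r, hr, fun x hx => h x (fun v hv => ?_)⟩
  rw [real_inner_comm]
  exact hv x hx

lemma ric_dual_interior {K : Set V} {u : V} {c : ℝ} (hc : 0 < c) (h : ∀ x ∈ K, c * ‖x‖ ≤ ⟪u, x⟫) :
    u ∈ interior (dualCone K) := by
  rw [mem_interior_iff_mem_nhds]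
  filter_upwards [Metric.ball_mem_nhds u hc] with v hv x hx
  rw [Metric.mem_ball, dist_eq_norm] at hv
  have h1 : ⟪x, v⟫ = ⟪u, x⟫ + ⟪v - u, x⟫ := by
    rw [← inner_add_left, real_inner_comm]; congr 1; abel
  have h2 := (abs_le.1 (abs_real_inner_le_norm (v - u) x)).1
  nlinarith [h x hx, norm_nonneg x]

lemma ric_dual_boundary {K : Set V} (hK : IsProperConvexCone K) {u : V} (hu : u ∈ dualCone K)
    (hn : u ∉ interior (dualCone K)) : ∃ x ∈ K, x ≠ 0 ∧ ⟪u, x⟫ = 0 := by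
  by_contra hcon
  push Not at hcon
  have hpos : ∀ x ∈ K, x ≠ 0 → 0 < ⟪u, x⟫ := fun x hx h0 =>
    lt_of_le_of_ne (by rw [real_inner_comm]; exact hu x hx) (hcon x hx h0).symm
  have hcpt : IsCompact (Metric.sphere (0:V) 1 ∩ K) := (isCompact_sphere 0 1).inter_right hK.isClosed
  apply hn
  have key : ∀ c : ℝ, (∀ x ∈ Metric.sphere (0:V) 1 ∩ K, c ≤ ⟪u, x⟫) → ∀ x ∈ K, c * ‖x‖ ≤ ⟪u, x⟫ := by
    intro c hc x hx
    rcases eq_or_ne x 0 with rfl | h0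
    · simp
    have hp : 0 < ‖x‖ := norm_pos_iff.2 h0
    have := hc (‖x‖⁻¹ • x) ⟨by simp [norm_smul, hp.ne'], hK.smul_mem _ (by positivity) x hx⟩
    rw [real_inner_smul_right, ← div_eq_inv_mul, le_div_iff₀ hp] at this
    exact this
  rcases (Metric.sphere (0:V) 1 ∩ K).eq_empty_or_nonempty with he | hne
  · exact ric_dual_interior one_pos (key 1 (by rw [he]; simp))
  · obtain ⟨x, hx, hmin⟩ := hcpt.exists_isMinOn hne (f := fun x => ⟪u, x⟫) (by fun_prop)
    refine ric_dual_interior (hpos x hx.2 ?_) (key _ (fun y hy => hmin hy))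
    rintro rfl
    simpa using hx.1

lemma ric_dual_closed (K : Set V) : IsClosed (dualCone K) := by
  have : dualCone K = ⋂ x ∈ K, {u | 0 ≤ ⟪x, u⟫} := by ext; simp [dualCone]
  rw [this]
  exact isClosed_biInter fun x _ => isClosed_le continuous_const (by fun_prop)

lemma ric_dual_add {K : Set V} {u v : V} (hu : u ∈ dualCone K) (hv : v ∈ dualCone K) :
    u + v ∈ dualCone K := fun x hx => by
  rw [inner_add_right]; exact add_nonneg (hu x hx) (hv x hx)

lemma ric_dual_smul {K : Set V} {u : V} {s : ℝ} (hs : 0 ≤ s) (hu : u ∈ dualCone K) :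
    s • u ∈ dualCone K := fun x hx => by
  rw [real_inner_smul_right]; exact mul_nonneg hs (hu x hx)

lemma ric_barrier {K : Set V} (hK : IsProperConvexCone K) {T : ℝ} {w w' : ℝ → V}
    (hd : ∀ t ∈ Icc 0 T, HasDerivWithinAt w (w' t) (Icc 0 T) t)
    (h0 : w 0 ∈ interior (dualCone K))
    (hp : ∀ t ∈ Icc 0 T, w t ∈ dualCone K → ∀ x ∈ K, x ≠ 0 → ⟪w t, x⟫ = 0 → 0 < ⟪w' t, x⟫) :
    ∀ t ∈ Icc 0 T, w t ∈ interior (dualCone K) := by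
  by_contra hcon
  push Not at hcon
  obtain ⟨t1, ht1, hbad⟩ := hcon
  have hcont : ContinuousOn w (Icc 0 T) := fun t ht => (hd t ht).continuousWithinAt
  let S : Set ℝ := Icc 0 T ∩ w ⁻¹' (interior (dualCone K))ᶜ
  have hSc : IsClosed S := hcont.preimage_isClosed_of_isClosed isClosed_Icc isOpen_interior.isClosed_compl
  have hSne : S.Nonempty := ⟨t1, ht1, hbad⟩
  have hSb : BddBelow S := ⟨0, fun t ht => ht.1.1⟩
  have hmem : sInf S ∈ S := hSc.csInf_mem hSne hSb
  set τ := sInf S with hτ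
  have hlt : ∀ t ∈ Icc 0 T, t < τ → w t ∈ interior (dualCone K) := by
    intro t ht h
    by_contra hb
    exact absurd (csInf_le hSb (show t ∈ S from ⟨ht, hb⟩)) (not_le.2 h)
  have hτ0 : 0 < τ := by
    rcases hmem.1.1.eq_or_lt with h | h
    · exact absurd (h ▸ h0) hmem.2
    · exact h
  have hev : ∀ᶠ t in 𝓝[<] τ, t ∈ Ico 0 τ := by
    filter_upwards [Ioo_mem_nhdsLT hτ0] with t ht using ⟨ht.1.le, ht.2⟩
  have hsub : Ico 0 τ ⊆ Icc 0 T := fun t ht => ⟨ht.1, ht.2.le.trans hmem.1.2⟩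
  have hd' := hd τ hmem.1
  have htend : Tendsto w (𝓝[<] τ) (𝓝 (w τ)) := by
    refine hd'.continuousWithinAt.tendsto.mono_left ?_
    rw [nhdsWithin_le_iff]
    filter_upwards [hev] with t ht using hsub ht
  have hwτ : w τ ∈ dualCone K :=
    (ric_dual_closed K).mem_of_tendsto htend (hev.mono fun t ht => interior_subset (hlt t (hsub ht) ht.2))
  obtain ⟨x, hx, hx0, hwx⟩ := ric_dual_boundary hK hwτ hmem.2
  have hpos := hp τ hmem.1 hwτ x hx hx0 hwx
  have hg : HasDerivWithinAt (fun t => ⟪w t, x⟫) ⟪w' τ, x⟫ (Icc 0 T) τ := by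
    simpa using hd'.inner ℝ (hasDerivWithinAt_const τ (Icc 0 T) x)
  have hg2 : HasDerivWithinAt (fun t => ⟪w t, x⟫) ⟪w' τ, x⟫ (Iio τ) τ := by
    refine hg.mono_of_mem_nhdsWithin ?_
    filter_upwards [hev] with t ht using hsub ht
  rw [hasDerivWithinAt_iff_tendsto_slope' (by simp)] at hg2
  have hle : ⟪w' τ, x⟫ ≤ 0 := by
    refine le_of_tendsto hg2 ?_
    filter_upwards [hev] with t ht
    rw [slope_def_field, hwx, sub_zero]
    have : 0 ≤ ⟪w t, x⟫ := by
      rw [real_inner_comm]; exact interior_subset (hlt t (hsub ht) ht.2) x hx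
    exact div_nonpos_of_nonneg_of_nonpos this (by linarith [ht.2])
  linarith

lemma ric_trunc {χ : V → V} (hχ : IsTruncation χ) :
    ∃ δ : ℝ, 0 < δ ∧ δ ≤ 1 ∧ ∀ ξ, ‖ξ‖ < δ → χ ξ = ξ := by
  obtain ⟨ε, hε, h⟩ := Metric.eventually_nhds_iff.1 hχ.2.2
  exact ⟨min ε 1, by positivity, min_le_right _ _, fun ξ hξ => h (by
    rw [dist_zero_right]; exact hξ.trans_le (min_le_left _ _))⟩

lemma ric_J_int {μ : Measure V} (h : (∫⁻ ξ, ENNReal.ofReal (min (‖ξ‖ ^ 2) 1) ∂μ) < ⊤) :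
    Integrable (fun ξ : V => min (‖ξ‖ ^ 2) 1) μ := by
  have hc : Continuous (fun ξ : V => min (‖ξ‖ ^ 2) 1) := by fun_prop
  refine ⟨hc.aestronglyMeasurable, ?_⟩
  rw [hasFiniteIntegral_iff_ofReal (Eventually.of_forall fun ξ => by positivity)]
  exact h

lemma ric_Lam {K : Set V} (hK : IsProperConvexCone K) {χ : V → V} {R : V → V} (P : RParams K χ R) :
    ∃ C : ℝ, 0 ≤ C ∧ ∀ x ∈ K, ∫ ξ, min (‖ξ‖ ^ 2) 1 ∂(P.M x) ≤ C * ‖x‖ := by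
  obtain ⟨x0, hx0⟩ := ric_interior hK
  obtain ⟨ρ, hρ, hb⟩ := Metric.isOpen_iff.1 isOpen_interior x0 hx0
  have hnn : ∀ μ : Measure V, 0 ≤ ∫ ξ, min (‖ξ‖ ^ 2) 1 ∂μ := fun μ =>
    integral_nonneg fun ξ => by positivity
  refine ⟨(2 / ρ) * ∫ ξ, min (‖ξ‖ ^ 2) 1 ∂(P.M x0), mul_nonneg (by positivity) (hnn _), fun x hx => ?_⟩
  rcases eq_or_ne x 0 with rfl | h0
  · have := P.M_smul 0 le_rfl 0 hx
    simp only [smul_zero, ENNReal.ofReal_zero, zero_smul] at this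
    rw [this]; simp
  have hn : 0 < ‖x‖ := norm_pos_iff.2 h0
  set s := ρ / 2 / ‖x‖ with hs
  have hs0 : 0 < s := by positivity
  have hy : x0 - s • x ∈ K := by
    apply interior_subset (hb _)
    rw [Metric.mem_ball, dist_eq_norm, sub_sub_cancel_left, norm_neg, norm_smul,
      Real.norm_of_nonneg (by positivity), hs, div_mul_cancel₀ _ hn.ne']
    linarith
  have hsx := hK.smul_mem s hs0.le x hx
  have h1 := P.M_add _ hy _ hsx
  rw [sub_add_cancel, P.M_smul s hs0.le x hx] at h1
  have h2 : ∫ ξ, min (‖ξ‖ ^ 2) 1 ∂(P.M x0) = ∫ ξ, min (‖ξ‖ ^ 2) 1 ∂(P.M (x0 - s • x)) +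
      s * ∫ ξ, min (‖ξ‖ ^ 2) 1 ∂(P.M x) := by
    rw [h1, integral_add_measure (ric_J_int (P.M_int _ hy))
      ((ric_J_int (P.M_int _ hx)).smul_measure ENNReal.ofReal_ne_top), integral_smul_measure,
      ENNReal.toReal_ofReal hs0.le, smul_eq_mul]
  have h3 : s * ∫ ξ, min (‖ξ‖ ^ 2) 1 ∂(P.M x) ≤ ∫ ξ, min (‖ξ‖ ^ 2) 1 ∂(P.M x0) := by
    rw [h2]; linarith [hnn (P.M (x0 - s • x))]
  rw [← le_div_iff₀' hs0] at h3
  refine h3.trans (le_of_eq ?_)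
  rw [hs]; field_simp

lemma ric_I_bounds {K : Set V} {χ : V → V} {R : V → V} (hχ : IsTruncation χ) (P : RParams K χ R)
    {δ : ℝ} (hδ : 0 < δ) (hδ1 : δ ≤ 1) (hχδ : ∀ ξ, ‖ξ‖ < δ → χ ξ = ξ)
    {u : V} (hu : u ∈ dualCone K) {x : V} (hx : x ∈ K) :
    -((1 + ‖u‖) / δ ^ 2) * (∫ ξ, min (‖ξ‖ ^ 2) 1 ∂(P.M x)) ≤
      ∫ ξ, (Real.exp (-⟪u, ξ⟫) - 1 + ⟪χ ξ, u⟫) ∂(P.M x) ∧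
    ∫ ξ, (Real.exp (-⟪u, ξ⟫) - 1 + ⟪χ ξ, u⟫) ∂(P.M x) ≤
      (‖u‖ ^ 2 + ‖u‖ / δ ^ 2) * ∫ ξ, min (‖ξ‖ ^ 2) 1 ∂(P.M x) := by
  have hae : ∀ᵐ ξ ∂(P.M x), ξ ∈ K := by rw [ae_iff]; exact P.M_supp x hx
  have hJ := ric_J_int (P.M_int x hx)
  have hu' : ∀ ξ ∈ K, 0 ≤ ⟪u, ξ⟫ := fun ξ hξ => by rw [real_inner_comm]; exact hu ξ hξ
  have hk := ric_k_integrable hχ.1 hχ.2.1 hδ hδ1 hχδ (P.M_supp x hx) hJ hu'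
  rw [← integral_const_mul, ← integral_const_mul]
  constructor
  · refine integral_mono_ae (hJ.const_mul _) hk ?_
    filter_upwards [hae] with ξ hξ using (ric_k_bound hχ.2.1 hδ hδ1 hχδ (hu' ξ hξ)).1
  · refine integral_mono_ae hk (hJ.const_mul _) ?_
    filter_upwards [hae] with ξ hξ using (ric_k_bound hχ.2.1 hδ hδ1 hχδ (hu' ξ hξ)).2

lemma ric_upper {K : Set V} {χ : V → V} {R : V → V} (hχ : IsTruncation χ) (P : RParams K χ R)
    {x : V} (hx : x ∈ K) :
    ∃ L : ℝ, 0 ≤ L ∧ ∀ u ∈ dualCone K, ⟪R u, x⟫ ≤ L * (1 + ‖u‖) := by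
  obtain ⟨δ, hδ, hδ1, hχδ⟩ := ric_trunc hχ
  let Bc := LinearMap.toContinuousLinearMap P.B
  have hΛ : 0 ≤ ∫ ξ, min (‖ξ‖ ^ 2) 1 ∂(P.M x) := integral_nonneg fun ξ => by positivity
  refine ⟨‖Bc‖ * ‖x‖ + ‖P.γ‖ * ‖x‖ + (∫ ξ, min (‖ξ‖ ^ 2) 1 ∂(P.M x)) / δ ^ 2, by positivity, fun u hu => ?_⟩
  rw [P.eq u hu x hx]
  have h1 := (ric_I_bounds hχ P hδ hδ1 hχδ hu hx).1
  have h2 : 0 ≤ ⟪P.Q u u, x⟫ := by rw [real_inner_comm]; exact P.Q_pos u x hx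
  have h3 : ⟪P.B u, x⟫ ≤ ‖Bc‖ * ‖u‖ * ‖x‖ := by
    refine (real_inner_le_norm _ _).trans ?_
    gcongr
    exact Bc.le_opNorm u
  have h4 : ⟪P.γ, x⟫ ≤ ‖P.γ‖ * ‖x‖ := real_inner_le_norm _ _
  have h5 : -((1 + ‖u‖) / δ ^ 2) * (∫ ξ, min (‖ξ‖ ^ 2) 1 ∂(P.M x)) =
    - ((∫ ξ, min (‖ξ‖ ^ 2) 1 ∂(P.M x)) / δ ^ 2 * (1 + ‖u‖)) := by ring
  have h6 : 0 ≤ ‖Bc‖ * ‖x‖ := by positivity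
  have h7 : 0 ≤ ‖P.γ‖ * ‖x‖ * ‖u‖ := by positivity
  nlinarith

lemma ric_lower {K : Set V} (hK : IsProperConvexCone K) {χ : V → V} {R : V → V}
    (hχ : IsTruncation χ) (P : RParams K χ R) {u : V} (hu : u ∈ interior (dualCone K)) :
    ∃ C : ℝ, 0 ≤ C ∧ ∀ s : ℝ, 0 < s → s ≤ 1 → ∀ x ∈ K, x ≠ 0 → 0 < ⟪R (s • u) + (C * s) • u, x⟫ := by
  obtain ⟨δ, hδ, hδ1, hχδ⟩ := ric_trunc hχ
  obtain ⟨CΛ, hCΛ, hΛ⟩ := ric_Lam hK P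
  obtain ⟨c, hc, hcu⟩ := ric_dual_strict hu
  set C1 := ‖P.Q u u‖ + ‖P.B u‖ + (‖u‖ ^ 2 + ‖u‖ / δ ^ 2) * CΛ with hC1
  have hC1n : 0 ≤ C1 := by positivity
  refine ⟨(C1 + 1) / c, by positivity, fun s hs hs1 x hx hx0 => ?_⟩
  have hn : 0 < ‖x‖ := norm_pos_iff.2 hx0
  have hsu : s • u ∈ dualCone K := ric_dual_smul hs.le (interior_subset hu)
  rw [inner_add_left, P.eq _ hsu x hx, real_inner_smul_left, map_smul, map_smul, map_smul]
  have h1 := (ric_I_bounds hχ P hδ hδ1 hχδ hsu hx).2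
  have h2 := hΛ x hx
  have hγ : 0 ≤ ⟪P.γ, x⟫ := by rw [real_inner_comm]; exact P.γ_mem x hx
  have hQ : ⟪P.Q u u, x⟫ ≤ ‖P.Q u u‖ * ‖x‖ := real_inner_le_norm _ _
  have hB : -(‖P.B u‖ * ‖x‖) ≤ ⟪P.B u, x⟫ := (abs_le.1 (abs_real_inner_le_norm _ _)).1
  have hQ0 : 0 ≤ ⟪P.Q u u, x⟫ := by rw [real_inner_comm]; exact P.Q_pos u x hx
  have h3 : ‖s • u‖ = s * ‖u‖ := by rw [norm_smul, Real.norm_of_nonneg hs.le]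
  rw [h3] at h1
  have hss : s ^ 2 ≤ s := by nlinarith
  have h4 : (s * ‖u‖) ^ 2 + s * ‖u‖ / δ ^ 2 ≤ s * (‖u‖ ^ 2 + ‖u‖ / δ ^ 2) := by
    have e : s * ‖u‖ / δ ^ 2 = s * (‖u‖ / δ ^ 2) := by ring
    rw [e]
    nlinarith [sq_nonneg ‖u‖]
  have h5 : ((s * ‖u‖) ^ 2 + s * ‖u‖ / δ ^ 2) * (∫ ξ, min (‖ξ‖ ^ 2) 1 ∂(P.M x)) ≤
      (s * (‖u‖ ^ 2 + ‖u‖ / δ ^ 2)) * (CΛ * ‖x‖) := by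
    have : 0 ≤ ∫ ξ, min (‖ξ‖ ^ 2) 1 ∂(P.M x) := integral_nonneg fun ξ => by positivity
    gcongr
  have h6 : (C1 + 1) * s * ‖x‖ ≤ (C1 + 1) / c * s * ⟪u, x⟫ := by
    have := hcu x hx
    calc (C1 + 1) * s * ‖x‖ = (C1 + 1) / c * s * (c * ‖x‖) := by field_simp
      _ ≤ _ := by gcongr
  have h7 : s ^ 2 * ⟪P.Q u u, x⟫ ≤ s * (‖P.Q u u‖ * ‖x‖) := by
    calc s ^ 2 * ⟪P.Q u u, x⟫ ≤ s * ⟪P.Q u u, x⟫ := by gcongr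
      _ ≤ _ := by gcongr
  have h8 : s * (-(‖P.B u‖ * ‖x‖)) ≤ s * ⟪P.B u, x⟫ := by gcongr
  have h9 : ⟪(s • P.Q u) (s • u), x⟫ = s ^ 2 * ⟪P.Q u u, x⟫ := by
    rw [LinearMap.smul_apply, map_smul, smul_smul, real_inner_smul_left]; ring
  have h10 : 0 < s * ‖x‖ := by positivity
  have h11 : 0 ≤ s ^ 2 * ⟪P.Q u u, x⟫ := by positivity
  rw [real_inner_smul_left]
  have h12 : ⟪s • (P.Q u) (s • u), x⟫ = s ^ 2 * ⟪P.Q u u, x⟫ := by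
    rw [map_smul, smul_smul, real_inner_smul_left]; ring
  simp only [LinearMap.smul_apply, map_smul, smul_smul, real_inner_smul_left] at *
  have h13 : (C1 + 1) * s * ‖x‖ = s * (‖P.Q u u‖ * ‖x‖) + s * (‖P.B u‖ * ‖x‖) +
      (s * (‖u‖ ^ 2 + ‖u‖ / δ ^ 2)) * (CΛ * ‖x‖) + s * ‖x‖ := by rw [hC1]; ring
  nlinarith

lemma ric_quasi {K : Set V} {χ : V → V} {R : V → V}
    (hχ : IsTruncation χ) (P : RParams K χ R) (hadm : P.Admissible) {u w : V} (hu : u ∈ dualCone K)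
    (hw : w ∈ dualCone K) {x : V} (hx : x ∈ K) (hwx : ⟪w, x⟫ = 0) :
    ⟪R u, x⟫ ≤ ⟪R (u + w), x⟫ := by
  obtain ⟨δ, hδ, hδ1, hχδ⟩ := ric_trunc hχ
  obtain ⟨hQ, hI, hB⟩ := hadm w hw x hx hwx
  have hv := ric_dual_add hu hw
  have hae : ∀ᵐ ξ ∂(P.M x), ξ ∈ K := by rw [ae_iff]; exact P.M_supp x hx
  have hJ := ric_J_int (P.M_int x hx)
  have hk : ∀ u ∈ dualCone K, Integrable (fun ξ => Real.exp (-⟪u, ξ⟫) - 1 + ⟪χ ξ, u⟫) (P.M x) :=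
    fun u hu => ric_k_integrable hχ.1 hχ.2.1 hδ hδ1 hχδ (P.M_supp x hx) hJ
      (fun ξ hξ => by rw [real_inner_comm]; exact hu ξ hξ)
  rw [P.eq u hu x hx, P.eq _ hv x hx]
  have h1 : ∫ ξ, (Real.exp (-⟪u + w, ξ⟫) - 1 + ⟪χ ξ, u + w⟫) ∂(P.M x) ≤
      ∫ ξ, (Real.exp (-⟪u, ξ⟫) - 1 + ⟪χ ξ, u⟫) ∂(P.M x) + ∫ ξ, ⟪χ ξ, w⟫ ∂(P.M x) := by
    rw [← integral_add (hk u hu) hI]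
    refine integral_mono_ae (hk _ hv) ((hk u hu).add hI) ?_
    filter_upwards [hae] with ξ hξ
    have h2 : 0 ≤ ⟪w, ξ⟫ := by rw [real_inner_comm]; exact hw ξ hξ
    have h3 : Real.exp (-⟪u + w, ξ⟫) ≤ Real.exp (-⟪u, ξ⟫) := by
      apply Real.exp_le_exp.2
      rw [inner_add_left]; linarith
    simp only [inner_add_right]
    linarith
  have h2 : ⟪P.Q (u + w) (u + w), x⟫ = ⟪P.Q u u, x⟫ := by
    simp only [map_add, LinearMap.add_apply, inner_add_left, P.Q_symm u w, hQ]
    ring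
  rw [h2, map_add, inner_add_left]
  linarith
end


section
set_option linter.unusedSectionVars false
variable {V : Type*} [NormedAddCommGroup V] [InnerProductSpace ℝ V] [FiniteDimensional ℝ V]
  [MeasurableSpace V] [BorelSpace V]

lemma ric_apriori {K : Set V} (hK : IsProperConvexCone K) {χ : V → V} {R : V → V}
    (hχ : IsTruncation χ) (P : RParams K χ R) (hadm : P.Admissible) {u : V}
    (hu : u ∈ interior (dualCone K)) {T : ℝ} :
    ∃ C : Set V, IsCompact C ∧ C ⊆ interior (dualCone K) ∧ ∀ T', T' ≤ T → ∀ α : ℝ → V,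
      α 0 = u → (∀ t ∈ Icc 0 T', α t ∈ interior (dualCone K) ∧
        HasDerivWithinAt α (R (α t)) (Icc 0 T') t) → ∀ t ∈ Icc 0 T', α t ∈ C := by
  obtain ⟨x0, hx0⟩ := ric_interior hK
  have hx0K := interior_subset hx0
  obtain ⟨r, hr, hrx⟩ := ric_strict hx0
  obtain ⟨L, hL, hLu⟩ := ric_upper hχ P hx0K
  obtain ⟨C, hC, hCl⟩ := ric_lower hK hχ P hu
  obtain ⟨c, hc, hcu⟩ := ric_dual_strict hu
  have hyn : ∀ v ∈ dualCone K, r * ‖v‖ ≤ ⟪v, x0⟫ := fun v hv => by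
    rw [real_inner_comm]; exact hrx v hv
  set L' := L * (1 + 1 / r) with hL'
  have hL'0 : 0 ≤ L' := by positivity
  have hup : ∀ v ∈ dualCone K, ⟪R v, x0⟫ ≤ L' * (1 + ⟪v, x0⟫) := by
    intro v hv
    refine (hLu v hv).trans ?_
    rw [hL', mul_assoc]
    gcongr
    have h1 := hyn v hv
    have h2 : ‖v‖ ≤ 1 / r * ⟪v, x0⟫ := by
      rw [one_div, le_inv_mul_iff₀ hr]; exact h1
    have h3 : 0 ≤ 1 / r := by positivity
    have h4 : 0 ≤ ⟪v, x0⟫ := le_trans (by positivity) h1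
    nlinarith
  set sT := 1 / 2 * Real.exp (-(C * T)) with hsT
  have hsT0 : 0 < sT := by positivity
  set N := Real.exp (L' * T) * (1 + ⟪u, x0⟫) / r with hN
  refine ⟨{v | v - sT • u ∈ dualCone K} ∩ Metric.closedBall 0 N, ?_, ?_, ?_⟩
  · refine (isCompact_closedBall 0 N).inter_left ?_
    exact (ric_dual_closed K).preimage (by fun_prop)
  · rintro v ⟨hv, -⟩
    refine ric_dual_interior (c := sT * c) (by positivity) (fun x hx => ?_)
    have h1 := hv x hx
    rw [inner_sub_right, real_inner_smul_right, real_inner_comm, real_inner_comm u x] at h1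
    nlinarith [hcu x hx]
  · intro T' hT' α hα0 hα t ht
    have hbar := ric_barrier hK (T := T') (w := fun t => α t - (1 / 2 * Real.exp (-(C * t))) • u)
      (w' := fun t => R (α t) + (C * (1 / 2 * Real.exp (-(C * t)))) • u) ?_ ?_ ?_
    · constructor
      · have h1 := interior_subset (hbar t ht)
        have h2 : 0 ≤ 1 / 2 * Real.exp (-(C * t)) - sT := by
          have : Real.exp (-(C * T)) ≤ Real.exp (-(C * t)) := by
            apply Real.exp_le_exp.2
            nlinarith [ht.2]
          rw [hsT]; linarith
        have h3 := ric_dual_add h1 (ric_dual_smul h2 (interior_subset hu))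
        show α t - sT • u ∈ dualCone K
        convert h3 using 1
        rw [sub_smul]; abel
      · have hcont : ContinuousOn α (Icc 0 T') := fun t ht => (hα t ht).2.continuousWithinAt
        have hz : AntitoneOn (fun t => Real.exp (-(L' * t)) * (1 + ⟪α t, x0⟫)) (Icc 0 T') := by
          have hder : ∀ t ∈ interior (Icc 0 T'), HasDerivAt (fun t => Real.exp (-(L' * t)) * (1 + ⟪α t, x0⟫))
              (Real.exp (-(L' * t)) * (-L') * (1 + ⟪α t, x0⟫) + Real.exp (-(L' * t)) * ⟪R (α t), x0⟫) t := by
            intro t ht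
            have h1 := (hα t (interior_subset ht)).2.hasDerivAt (mem_interior_iff_mem_nhds.1 ht)
            have h2 : HasDerivAt (fun t => 1 + ⟪α t, x0⟫) ⟪R (α t), x0⟫ t := by
              simpa using (h1.inner ℝ (hasDerivAt_const t x0)).const_add 1
            have h3 : HasDerivAt (fun t => Real.exp (-(L' * t))) (Real.exp (-(L' * t)) * (-L')) t := by
              have := ((hasDerivAt_id t).const_mul L').neg.exp
              simpa using this
            exact h3.mul h2
          refine antitoneOn_of_deriv_nonpos (convex_Icc _ _) ?_ ?_ ?_
          · exact ContinuousOn.mul (by fun_prop) (continuousOn_const.add (hcont.inner continuousOn_const))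
          · exact fun t ht => (hder t ht).differentiableAt.differentiableWithinAt
          · intro t ht
            rw [(hder t ht).deriv]
            have h1 := hup _ (interior_subset (hα t (interior_subset ht)).1)
            have h2 := Real.exp_pos (-(L' * t))
            nlinarith
        have h1 := hz ⟨le_rfl, ht.1.trans ht.2⟩ ht ht.1
        simp only [mul_zero, neg_zero, Real.exp_zero, one_mul, hα0] at h1
        rw [Real.exp_neg, inv_mul_le_iff₀ (Real.exp_pos _)] at h1
        have h2 := hyn _ (interior_subset (hα t ht).1)
        have h3 : 0 ≤ ⟪u, x0⟫ := le_trans (by positivity) (hyn u (interior_subset hu))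
        have h4 : Real.exp (L' * t) * (1 + ⟪u, x0⟫) ≤ Real.exp (L' * T) * (1 + ⟪u, x0⟫) := by
          gcongr
          exact ht.2.trans hT'
        rw [mem_closedBall_zero_iff, hN, le_div_iff₀ hr]
        linarith
    · intro t ht
      have h1 := (hα t ht).2
      have h3 : HasDerivAt (fun t => Real.exp (-(C * t))) (Real.exp (-(C * t)) * (-C)) t := by
        have := ((hasDerivAt_id t).const_mul C).neg.exp
        simpa using this
      have h4 := ((h3.const_mul (1/2)).smul_const u).hasDerivWithinAt (s := Icc 0 T')
      have h5 := h1.sub h4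
      refine h5.congr_deriv ?_
      rw [sub_eq_add_neg, ← neg_smul]
      congr 2
      ring
    · have h1 : α 0 - (1 / 2 * Real.exp (-(C * 0))) • u = (1/2 : ℝ) • u := by
        rw [hα0]
        simp only [mul_zero, neg_zero, Real.exp_zero, mul_one]
        rw [sub_eq_iff_eq_add, ← add_smul]; norm_num
      rw [h1]
      refine ric_dual_interior (c := 1/2 * c) (by positivity) (fun x hx => ?_)
      rw [real_inner_smul_left]
      nlinarith [hcu x hx]
    · intro t ht hw x hx hxne hwx
      set s := 1 / 2 * Real.exp (-(C * t)) with hs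
      have hs0 : 0 < s := by positivity
      have hs1 : s ≤ 1 := by
        have : Real.exp (-(C * t)) ≤ 1 := Real.exp_le_one_iff.2 (by nlinarith [ht.1])
        rw [hs]; linarith
      have h1 := ric_quasi hχ P hadm (ric_dual_smul hs0.le (interior_subset hu)) hw hx hwx
      rw [add_sub_cancel] at h1
      have h2 := hCl s hs0 hs1 x hx hxne
      rw [inner_add_left] at h2 ⊢
      linarith

lemma ric_R_analytic {K : Set V} (hK : IsProperConvexCone K) {χ : V → V} {R : V → V}
    (hχ : IsTruncation χ) (P : RParams K χ R) : AnalyticOnNhd ℝ R (interior (dualCone K)) := by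
  intro u hu
  obtain ⟨δ, hδ, hδ1, hχδ⟩ := ric_trunc hχ
  obtain ⟨c, hc, hcu⟩ := ric_dual_strict hu
  have hnh : ∀ᶠ v in 𝓝 u, v ∈ dualCone K := by
    filter_upwards [isOpen_interior.mem_nhds hu] with v hv using interior_subset hv
  have h1 : ∀ x ∈ K, AnalyticAt ℝ (fun v => ⟪x, R v⟫) u := by
    intro x hx
    let Qc : V →L[ℝ] V →L[ℝ] V := LinearMap.toContinuousLinearMap
      ((LinearMap.toContinuousLinearMap : (V →ₗ[ℝ] V) ≃ₗ[ℝ] (V →L[ℝ] V)).toLinearMap ∘ₗ P.Q)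
    let Bc : V →L[ℝ] V := LinearMap.toContinuousLinearMap P.B
    have hQ : AnalyticAt ℝ (fun v => Qc v v) u :=
      AnalyticAt.fun_comp (g := fun q : V × V => Qc q.1 q.2) (f := fun v : V => (v, v)) (Qc.analyticAt_bilinear (u, u))
        (AnalyticAt.prod (f := fun v : V => v) (g := fun v : V => v) analyticAt_id analyticAt_id)
    have hQ' : AnalyticAt ℝ (fun v => innerSL ℝ x (Qc v v)) u := ((innerSL ℝ x).analyticAt _).fun_comp hQ
    have hB' : AnalyticAt ℝ (fun v => innerSL ℝ x (Bc v)) u :=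
      ((innerSL ℝ x).analyticAt _).fun_comp (Bc.analyticAt u)
    have hI := ric_I_analytic hχ.1 hχ.2.1 hδ hδ1 hχδ (P.M_supp x hx) (ric_J_int (P.M_int x hx)) hc hcu
    refine ((((analyticAt_const (v := (-(1/2) : ℝ))).mul hQ').add hB').add
      (analyticAt_const (v := ⟪P.γ, x⟫)) |>.sub hI).congr ?_
    filter_upwards [hnh] with v hv
    rw [real_inner_comm (R v) x, P.eq v hv x hx, real_inner_comm x (P.Q v v), real_inner_comm x (P.B v)]
    rfl
  have h2 : ∀ y : V, AnalyticAt ℝ (fun v => ⟪y, R v⟫) u := by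
    intro y
    obtain ⟨a, ha, b, hb, rfl⟩ := hK.generating y
    simp_rw [inner_sub_left]
    exact (h1 a ha).sub (h1 b hb)
  let e := stdOrthonormalBasis ℝ V
  have h3 : R = fun v => ∑ i, ⟪e i, R v⟫ • e i := by
    funext v; exact (e.sum_repr' (R v)).symm
  rw [h3]
  exact Finset.analyticAt_fun_sum _ fun i _ => (h2 (e i)).smul analyticAt_const

lemma ric_F_analytic {K : Set V} {χ : V → V} {F : V → ℝ}
    (hχ : IsTruncation χ) (P : FParams K F) : AnalyticOnNhd ℝ F (interior (dualCone K)) := by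
  intro u hu
  obtain ⟨δ, hδ, hδ1, hχδ⟩ := ric_trunc hχ
  obtain ⟨c, hc, hcu⟩ := ric_dual_strict hu
  have hnh : ∀ᶠ v in 𝓝 u, v ∈ dualCone K := by
    filter_upwards [isOpen_interior.mem_nhds hu] with v hv using interior_subset hv
  have hJ1 : Integrable (fun ξ : V => min ‖ξ‖ 1) P.m := by
    have hc : Continuous (fun ξ : V => min ‖ξ‖ 1) := by fun_prop
    refine ⟨hc.aestronglyMeasurable, ?_⟩
    rw [hasFiniteIntegral_iff_ofReal (Eventually.of_forall fun ξ => by positivity)]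
    exact P.m_int
  have hJ : Integrable (fun ξ : V => min (‖ξ‖ ^ 2) 1) P.m := by
    have hc : Continuous (fun ξ : V => min (‖ξ‖ ^ 2) 1) := by fun_prop
    refine hJ1.mono' hc.aestronglyMeasurable (Eventually.of_forall fun ξ => ?_)
    rw [Real.norm_of_nonneg (by positivity)]
    rcases le_total ‖ξ‖ 1 with h | h
    · rw [min_eq_left h]
      exact (min_le_left _ _).trans (by nlinarith [norm_nonneg ξ])
    · rw [min_eq_right h]
      exact min_le_right _ _
  have hχi : Integrable χ P.m := by
    refine (hJ1.const_mul (1/δ)).mono' hχ.1.aestronglyMeasurable (Eventually.of_forall fun ξ => ?_)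
    rw [one_div, le_inv_mul_iff₀ hδ]
    rcases lt_or_ge ‖ξ‖ δ with h | h
    · rw [hχδ ξ h, min_eq_left (h.le.trans hδ1)]
      nlinarith [norm_nonneg ξ]
    · refine le_trans ?_ (le_min h hδ1)
      nlinarith [hχ.2.1 ξ]
  have hI := ric_I_analytic hχ.1 hχ.2.1 hδ hδ1 hχδ P.m_supp hJ hc hcu
  refine ((((innerSL ℝ P.b).analyticAt u).add (analyticAt_const (v := P.c))).sub
    (hI.sub ((innerSL ℝ (∫ ξ, χ ξ ∂P.m)).analyticAt u))).congr ?_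
  filter_upwards [hnh] with v hv
  rw [P.eq v hv]
  have hk := ric_k_integrable hχ.1 hχ.2.1 hδ hδ1 hχδ P.m_supp hJ
    (u := v) (fun ξ hξ => by rw [real_inner_comm]; exact hv ξ hξ)
  have e1 : ∫ ξ, ⟪χ ξ, v⟫ ∂P.m = ⟪∫ ξ, χ ξ ∂P.m, v⟫ := by
    simp_rw [real_inner_comm v]
    exact integral_inner hχi _
  have e2 := integral_sub hk (hχi.inner_const (𝕜 := ℝ) v)
  simp only [add_sub_cancel_right] at e2
  simp only [Pi.add_apply, Pi.sub_apply, innerSL_apply_apply]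
  rw [e2, e1]

lemma ric_F_nonneg {K : Set V} {F : V → ℝ} (P : FParams K F) {u : V} (hu : u ∈ dualCone K) :
    0 ≤ F u := by
  rw [P.eq u hu]
  have hae : ∀ᵐ ξ ∂P.m, ξ ∈ K := by rw [ae_iff]; exact P.m_supp
  have h1 : ∫ ξ, (Real.exp (-⟪u, ξ⟫) - 1) ∂P.m ≤ 0 := by
    refine integral_nonpos_of_ae ?_
    filter_upwards [hae] with ξ hξ
    have h2 : 0 ≤ ⟪u, ξ⟫ := by rw [real_inner_comm]; exact hu ξ hξ
    have : Real.exp (-⟪u, ξ⟫) ≤ 1 := Real.exp_le_one_iff.2 (by linarith)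
    simp only [Pi.zero_apply]
    linarith
  have := hu P.b P.b_mem
  linarith [P.c_nonneg]
end

/-- For `F` of form (F) and `R` of form (R) with admissible
parameters, and for every `u ∈ K̊*`, there exists a unique global
`ℝ₊ × K̊*`-valued solution `(φ(·,u), ψ(·,u))` of the generalized Riccati equations
`∂ₜφ = F(ψ)`, `φ(0,u) = 0`, `∂ₜψ = R(ψ)`, `ψ(0,u) = u`; moreover `φ` and `ψ` are
real-analytic in `(t,u) ∈ ℝ₊ × K̊*` in the sense that every such point has a
neighborhood in `ℝ × V` on which the solution extends real-analytically. -/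
theorem riccati_global_solution
    {V : Type*} [NormedAddCommGroup V] [InnerProductSpace ℝ V] [FiniteDimensional ℝ V]
    [MeasurableSpace V] [BorelSpace V]
    (K : Set V) (hK : IsProperConvexCone K)
    (χ : V → V) (hχ : IsTruncation χ)
    (F : V → ℝ) (R : V → V)
    (PF : FParams K F) (PR : RParams K χ R) (hadm : PR.Admissible) :
    ∃ φ : ℝ → V → ℝ, ∃ ψ : ℝ → V → V,
      (∀ u ∈ interior (dualCone K),
        φ 0 u = 0 ∧ ψ 0 u = u ∧
        (∀ t : ℝ, 0 ≤ t →
          0 ≤ φ t u ∧ ψ t u ∈ interior (dualCone K) ∧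
          HasDerivWithinAt (fun s => φ s u) (F (ψ t u)) (Set.Ici (0 : ℝ)) t ∧
          HasDerivWithinAt (fun s => ψ s u) (R (ψ t u)) (Set.Ici (0 : ℝ)) t) ∧
        (∀ (g : ℝ → ℝ) (h : ℝ → V), g 0 = 0 → h 0 = u →
          (∀ t : ℝ, 0 ≤ t →
            0 ≤ g t ∧ h t ∈ interior (dualCone K) ∧
            HasDerivWithinAt g (F (h t)) (Set.Ici (0 : ℝ)) t ∧
            HasDerivWithinAt h (R (h t)) (Set.Ici (0 : ℝ)) t) →
          ∀ t : ℝ, 0 ≤ t → g t = φ t u ∧ h t = ψ t u)) ∧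
      (∀ t : ℝ, 0 ≤ t → ∀ u ∈ interior (dualCone K),
        ∃ U ∈ nhds ((t, u) : ℝ × V), ∃ Φ : ℝ × V → ℝ, ∃ Ψ : ℝ × V → V,
          AnalyticOnNhd ℝ Φ U ∧ AnalyticOnNhd ℝ Ψ U ∧
          ∀ q ∈ U, 0 ≤ q.1 → q.2 ∈ interior (dualCone K) →
            Φ q = φ q.1 q.2 ∧ Ψ q = ψ q.1 q.2) := by
  classical
  let Ω : Set (ℝ × V) := Set.univ ×ˢ interior (dualCone K)
  let W : ℝ × V → ℝ × V := fun q => (F q.2, R q.2)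
  have hΩ : IsOpen Ω := isOpen_univ.prod isOpen_interior
  have hFa := ric_F_analytic hχ PF
  have hRa := ric_R_analytic hK hχ PR
  have hW : AnalyticOnNhd ℝ W Ω := by
    intro q hq
    have hs : AnalyticAt ℝ (fun q : ℝ × V => q.2) q := analyticAt_snd
    exact (AnalyticAt.fun_comp (hFa q.2 hq.2) hs).prod (AnalyticAt.fun_comp (hRa q.2 hq.2) hs)
  have hsnd : ∀ {s : Set ℝ} {t : ℝ} {α : ℝ → ℝ × V} {d : ℝ × V}, HasDerivWithinAt α d s t →
      HasDerivWithinAt (fun t => (α t).2) d.2 s t := fun h =>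
    (ContinuousLinearMap.snd ℝ ℝ V).hasFDerivAt.comp_hasDerivWithinAt _ h
  have hfst : ∀ {s : Set ℝ} {t : ℝ} {α : ℝ → ℝ × V} {d : ℝ × V}, HasDerivWithinAt α d s t →
      HasDerivWithinAt (fun t => (α t).1) d.1 s t := fun h =>
    (ContinuousLinearMap.fst ℝ ℝ V).hasFDerivAt.comp_hasDerivWithinAt _ h
  have hap : ∀ x ∈ Ω, ∀ T, 0 ≤ T → ∃ C, IsCompact C ∧ C ⊆ Ω ∧ ∀ T', 0 ≤ T' → T' ≤ T →
      ∀ α, RicSol W Ω x T' α → α T' ∈ C := by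
    rintro ⟨a, u⟩ ⟨-, hu⟩ T hT
    obtain ⟨C, hC, hCi, hCb⟩ := ric_apriori hK hχ PR hadm hu (T := T)
    have hFc : ContinuousOn F C := fun v hv => (hFa v (hCi hv)).continuousAt.continuousWithinAt
    obtain ⟨N, hN⟩ := hC.exists_bound_of_continuousOn hFc
    refine ⟨Metric.closedBall a (|N| * T) ×ˢ C, (isCompact_closedBall _ _).prod hC,
      fun q hq => ⟨trivial, hCi hq.2⟩, fun T' h0 hT' α hα => ?_⟩
    have h2 : ∀ t ∈ Icc 0 T', (α t).2 ∈ C := by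
      refine hCb T' hT' (fun t => (α t).2) ?_ (fun t ht => ⟨(hα.2 t ht).1.2, hsnd (hα.2 t ht).2⟩)
      simp [hα.1]
    refine ⟨?_, h2 T' ⟨h0, le_rfl⟩⟩
    have h3 := (convex_Icc 0 T').norm_image_sub_le_of_norm_hasDerivWithin_le
      (f := fun t => (α t).1) (f' := fun t => F (α t).2) (C := |N|)
      (fun t ht => hfst (hα.2 t ht).2) (fun t ht => (hN _ (h2 t ht)).trans (le_abs_self N))
      (⟨le_rfl, h0⟩ : (0:ℝ) ∈ Icc 0 T') (⟨h0, le_rfl⟩ : T' ∈ Icc 0 T')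
    simp only [hα.1, sub_zero, Real.norm_of_nonneg h0] at h3
    rw [Metric.mem_closedBall, dist_eq_norm]
    refine h3.trans ?_
    gcongr
  obtain ⟨Ψ, hΨ, hΨa⟩ := ric_flow hΩ hW hap
  have hmem : ∀ u ∈ interior (dualCone K), ((0:ℝ), u) ∈ Ω := fun u hu => ⟨trivial, hu⟩
  refine ⟨fun t u => (Ψ t (0, u)).1, fun t u => (Ψ t (0, u)).2, ?_, ?_⟩
  · intro u hu
    have hS := hΨ (0, u) (hmem u hu)
    have h0 : Ψ 0 (0, u) = (0, u) := (hS 0 le_rfl).1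
    have hder : ∀ t, 0 ≤ t → HasDerivWithinAt (fun s => Ψ s (0, u)) (W (Ψ t (0, u))) (Ici 0) t := by
      intro t ht
      refine ((hS (t + 1) (by linarith)).2 t ⟨ht, by linarith⟩).2.mono_of_mem_nhdsWithin ?_
      filter_upwards [self_mem_nhdsWithin, mem_nhdsWithin_of_mem_nhds (Iio_mem_nhds (show t < t + 1 by linarith))]
        with s hs hs' using ⟨hs, hs'.le⟩
    have hin : ∀ t, 0 ≤ t → (Ψ t (0, u)).2 ∈ interior (dualCone K) := fun t ht =>
      ((hS t ht).2 t ⟨ht, le_rfl⟩).1.2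
    refine ⟨by simp [h0], by simp [h0], ?_, ?_⟩
    · intro t ht
      refine ⟨?_, hin t ht, hfst (hder t ht), hsnd (hder t ht)⟩
      have hmono : MonotoneOn (fun s => (Ψ s (0, u)).1) (Ici 0) := by
        refine monotoneOn_of_hasDerivWithinAt_nonneg (convex_Ici 0)
          (f' := fun t => F (Ψ t (0, u)).2)
          (fun t ht => (hfst (hder t ht)).continuousWithinAt)
          (fun t ht => (hfst (hder t (interior_subset ht))).mono interior_subset)
          (fun t ht => ric_F_nonneg PF (interior_subset (hin t (interior_subset ht))))
      have := hmono (mem_Ici.2 le_rfl) (mem_Ici.2 ht) ht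
      simpa [h0] using this
    · intro g h hg0 hh0 hgh t ht
      have hsol : RicSol W Ω (0, u) t (fun s => (g s, h s)) := by
        refine ⟨by simp [hg0, hh0], fun s hs => ?_⟩
        obtain ⟨-, h2, h3, h4⟩ := hgh s hs.1
        exact ⟨⟨trivial, h2⟩, (h3.prodMk h4).mono Icc_subset_Ici_self⟩
      have := ric_uniq hW hsol (hS t ht) ⟨ht, le_rfl⟩
      exact ⟨congrArg Prod.fst this, congrArg Prod.snd this⟩
  · intro t ht u hu
    obtain ⟨Φ, hΦ, hev⟩ := hΨa t ht (0, u) (hmem u hu)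
    let ι : ℝ × V → ℝ × (ℝ × V) := fun q => (q.1, (0, q.2))
    have hι : ∀ q, AnalyticAt ℝ ι q := fun q =>
      analyticAt_fst.prod (analyticAt_const.prod analyticAt_snd)
    have hιc : Tendsto ι (𝓝 (t, u)) (𝓝 (t, (0, u))) := (hι (t, u)).continuousAt
    have hev2 := hιc.eventually (hΦ.eventually_analyticAt.and hev)
    refine ⟨{q | AnalyticAt ℝ Φ (ι q) ∧ (0 ≤ (ι q).1 → Φ (ι q) = Ψ (ι q).1 (ι q).2)}, hev2,
      fun q => (Φ (ι q)).1, fun q => (Φ (ι q)).2, ?_, ?_, ?_⟩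
    · intro q hq
      exact AnalyticAt.fun_comp (g := fun p : ℝ × V => p.1) analyticAt_fst (AnalyticAt.fun_comp hq.1 (hι q))
    · intro q hq
      exact AnalyticAt.fun_comp (g := fun p : ℝ × V => p.2) analyticAt_snd (AnalyticAt.fun_comp hq.1 (hι q))
    · intro q hq h0 _
      have := hq.2 h0
      exact ⟨congrArg Prod.fst this, congrArg Prod.snd this⟩
end
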